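/- Let h ≥ 1 be an integer. Then there exists a constant β_h lying in the ℚ-vector space spanned by 1 and log 2 such that b_h(n) ~ β_h · (3^{1/4}/(2π n^{1/4})) · e^{π√(n/3)} as n → ∞; moreover β_h ∈ ℚ if and only if h is even. -/

import Mathlib

open Finset

/-- The number of parts of the partition `P` that are greater than `j`;
this is the length of column `j` (0-indexed) of the Ferrers diagram,
i.e. the conjugate part `λ'_{j+1}`. -/
def colLen {n : ℕ} (P : Nat.Partition n) (j : ℕ) : ℕ :=
  (P.parts.filter (fun p => j < p)).card

/-- The length of row `i` (0-indexed) of the Ferrers diagram of `P`,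
i.e. the `(i+1)`-st largest part `λ_{i+1}` (or `0` if there is none). -/
def rowLen {n : ℕ} (P : Nat.Partition n) (i : ℕ) : ℕ :=
  ((Finset.range (n + 1)).filter (fun j => i < colLen P j)).card

/-- The number of cells of the Ferrers diagram of `P` whose hook number
`(λ_i − j) + (λ'_j − i) + 1` (1-indexed) equals `h`. -/
def hookCount {n : ℕ} (P : Nat.Partition n) (h : ℕ) : ℕ :=
  (((Finset.range (n + 1)) ×ˢ (Finset.range (n + 1))).filter
    (fun ij => ij.2 < rowLen P ij.1 ∧
      rowLen P ij.1 + colLen P ij.2 = h + ij.1 + ij.2 + 1)).card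

/-- `a h n`: the total number of hooks of length `h` among partitions of `n` into odd parts. -/
def hookOdd (h n : ℕ) : ℕ := ∑ P ∈ Nat.Partition.odds n, hookCount P h

/-- `b h n`: the total number of hooks of length `h` among partitions of `n` into distinct parts. -/
def hookDistinct (h n : ℕ) : ℕ := ∑ P ∈ Nat.Partition.distincts n, hookCount P h

theorem irrational_log_two : Irrational (Real.log 2) := by
  rintro ⟨q, hq⟩
  have hlog : 0 < Real.log 2 := Real.log_pos one_lt_two
  have hq0 : 0 < q := by rw [← hq] at hlog; exact_mod_cast hlog
  obtain ⟨a, ha⟩ : ∃ a : ℕ, q.num = a := ⟨q.num.toNat, by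
    have := Rat.num_pos.2 hq0
    omega⟩
  have ha0 : 0 < a := by
    have := Rat.num_pos.2 hq0
    omega
  have hexp : Real.exp a = 2 ^ q.den := by
    have h1 : (a : ℝ) = q.den * Real.log 2 := by
      have h2 : (q : ℝ) = q.num / q.den := Rat.cast_def q
      have h3 : (q.den : ℝ) ≠ 0 := by exact_mod_cast q.den_nz
      rw [← hq, h2, ha]
      field_simp
      simp
    rw [h1, mul_comm, Real.exp_mul, Real.exp_log two_pos, Real.rpow_natCast]
  have hexpC : Complex.exp (a : ℂ) = 2 ^ q.den := by
    have := congrArg (fun x : ℝ => (x : ℂ)) hexp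
    simpa using this
  obtain ⟨c, hc⟩ := LindemannWeierstrass.exp_polynomial_approx (Polynomial.X - Polynomial.C (a : ℤ))
    (by simp; omega)
  have hlim : Filter.Tendsto (fun n : ℕ => c * (c ^ n / n.factorial)) Filter.atTop (nhds 0) := by
    simpa using (FloorSemiring.tendsto_pow_div_factorial_atTop c).const_mul c
  have hev := hlim.eventually (gt_mem_nhds one_pos)
  obtain ⟨N, hN⟩ := Filter.eventually_atTop.1 hev
  obtain ⟨p, hp, hpp⟩ := Nat.exists_infinite_primes (N + a + 3)
  obtain ⟨n, hn, gp, -, hgp⟩ := hc p (by simp; omega) hpp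
  have hroot : (a : ℂ) ∈ (Polynomial.X - Polynomial.C (a : ℤ)).aroots ℂ :=
    Polynomial.mem_aroots.2 ⟨Polynomial.X_sub_C_ne_zero _, by simp⟩
  have h1 := hgp hroot
  have h2 := hN (p - 1) (by omega)
  have h3 : c * (c ^ (p - 1) / ((p - 1).factorial : ℝ)) = c ^ p / ((p - 1).factorial : ℝ) := by
    conv_rhs => rw [← Nat.sub_add_cancel hpp.one_le, pow_succ]
    simp only [Nat.add_sub_cancel]
    ring
  rw [h3] at h2
  have h4 : (n • Complex.exp (a : ℂ) - p • Polynomial.aeval (a : ℂ) gp)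
      = ((n * 2 ^ q.den - p * gp.eval (a : ℤ) : ℤ) : ℂ) := by
    have : Polynomial.aeval (a : ℂ) gp = ((gp.eval (a : ℤ) : ℤ) : ℂ) := by
      have := Polynomial.aeval_algebraMap_apply ℂ (a : ℤ) gp
      simpa using this
    rw [hexpC, this]
    simp
  rw [h4, Complex.norm_intCast] at h1
  have h5 : |n * 2 ^ q.den - p * gp.eval (a : ℤ)| < 1 := by
    have := h1.trans_lt h2
    exact_mod_cast this
  have h6 : n * 2 ^ q.den = p * gp.eval (a : ℤ) := by
    have := Int.abs_lt_one_iff.1 h5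
    omega
  have hprime : Prime (p : ℤ) := Nat.prime_iff_prime_int.1 hpp
  have h7 : (p : ℤ) ∣ n * 2 ^ q.den := ⟨_, h6⟩
  rcases hprime.dvd_or_dvd h7 with h | h
  · exact hn h
  · have h8 := hprime.dvd_of_dvd_pow h
    have := Int.le_of_dvd two_pos h8
    omega

/-- The number of hooks of length `h` in the Ferrers diagram whose rows are the elements of `A`:
a cell is determined by its column `j` and by the part `m` forming its row. -/
def setHookCount (h n : ℕ) (A : Finset ℕ) : ℕ :=
  #{x ∈ range (n + 1) ×ˢ A | x.1 < x.2 ∧ x.2 + #(A ∩ Ioo x.1 x.2) = h + x.1}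

lemma Nat.Partition.toFinset_val_of_mem_distincts {n : ℕ} {P : Nat.Partition n}
    (hP : P ∈ Nat.Partition.distincts n) : P.parts.toFinset.val = P.parts := by
  rw [Multiset.toFinset_val, Multiset.dedup_eq_self]
  simpa [Nat.Partition.distincts] using hP

lemma colLen_eq_card {n : ℕ} {P : Nat.Partition n} (hP : P ∈ Nat.Partition.distincts n) (j : ℕ) :
    colLen P j = #{p ∈ P.parts.toFinset | j < p} := by
  rw [colLen, Finset.card_def, Finset.filter_val, Nat.Partition.toFinset_val_of_mem_distincts hP]

lemma colLen_antitone {n : ℕ} (P : Nat.Partition n) : Antitone (colLen P) := by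
  intro i j hij
  exact Multiset.card_le_card (Multiset.monotone_filter_right _ fun p hp => lt_of_le_of_lt hij hp)

lemma Nat.Partition.le_of_mem_parts_toFinset {n : ℕ} {P : Nat.Partition n} {m : ℕ}
    (hm : m ∈ P.parts.toFinset) : m ≤ n :=
  P.le_of_mem_parts (Multiset.mem_toFinset.1 hm)

lemma colLen_lt_of_mem {n : ℕ} {P : Nat.Partition n} (hP : P ∈ Nat.Partition.distincts n) {m j : ℕ}
    (hm : m ∈ P.parts.toFinset) : colLen P m < colLen P j ↔ j < m := by
  constructor
  · intro h
    by_contra hjm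
    exact absurd h (not_lt.2 (colLen_antitone P (not_lt.1 hjm)))
  · intro h
    rw [colLen_eq_card hP, colLen_eq_card hP]
    apply Finset.card_lt_card
    rw [Finset.ssubset_iff_of_subset]
    · exact ⟨m, by simp_all, by simp⟩
    · intro p hp
      simp only [mem_filter] at hp ⊢
      exact ⟨hp.1, h.trans hp.2⟩

lemma rowLen_colLen {n : ℕ} {P : Nat.Partition n} (hP : P ∈ Nat.Partition.distincts n) {m : ℕ}
    (hm : m ∈ P.parts.toFinset) : rowLen P (colLen P m) = m := by
  have hmn := Nat.Partition.le_of_mem_parts_toFinset hm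
  have : (Finset.range (n + 1)).filter (fun j => colLen P m < colLen P j) = range m := by
    ext j
    simp only [mem_filter, mem_range, colLen_lt_of_mem hP hm]
    omega
  rw [rowLen, this, card_range]

lemma colLen_eq_zero {n : ℕ} (P : Nat.Partition n) : colLen P n = 0 := by
  rw [colLen, Multiset.card_eq_zero, Multiset.filter_eq_nil]
  intro p hp
  exact not_lt.2 (P.le_of_mem_parts hp)

lemma exists_mem_colLen_eq {n : ℕ} {P : Nat.Partition n} (hP : P ∈ Nat.Partition.distincts n)
    {i j : ℕ} (hij : j < rowLen P i) : ∃ m ∈ P.parts.toFinset, colLen P m = i := by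
  have hex : ∃ k, colLen P k ≤ i := ⟨n, by rw [colLen_eq_zero]; exact Nat.zero_le _⟩
  classical
  set m := Nat.find hex with hm
  have h1 : colLen P m ≤ i := Nat.find_spec hex
  have hm0 : m ≠ 0 := by
    intro h0
    have : rowLen P i = 0 := by
      rw [rowLen, Finset.card_eq_zero, Finset.filter_eq_empty_iff]
      intro k _
      rw [h0] at h1
      exact not_lt.2 ((colLen_antitone P (Nat.zero_le k)).trans h1)
    omega
  have h2 : i < colLen P (m - 1) := not_le.1 (Nat.find_min hex (m := m - 1) (by omega))
  have h3 : ∀ p, m - 1 < p ↔ m < p ∨ p = m := by omega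
  have h4 : colLen P (m - 1) = colLen P m + #{p ∈ P.parts.toFinset | p = m} := by
    rw [colLen_eq_card hP, colLen_eq_card hP, ← Finset.card_union_of_disjoint]
    · congr 1
      rw [← Finset.filter_or]
      exact Finset.filter_congr fun p _ => h3 p
    · rw [Finset.disjoint_filter]
      intro p _ h
      omega
  have hmem : m ∈ P.parts.toFinset := by
    by_contra hcon
    rw [Finset.filter_eq', if_neg hcon] at h4
    simp at h4
    omega
  rw [Finset.filter_eq', if_pos hmem, card_singleton] at h4
  exact ⟨m, hmem, by omega⟩

lemma hookCount_eq_setHookCount {n : ℕ} {P : Nat.Partition n}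
    (hP : P ∈ Nat.Partition.distincts n) (h : ℕ) :
    hookCount P h = setHookCount h n P.parts.toFinset := by
  symm
  have key : ∀ m ∈ P.parts.toFinset, ∀ j < m, colLen P j
      = #(P.parts.toFinset ∩ Ioo j m) + 1 + colLen P m := by
    intro m hm j hj
    rw [colLen_eq_card hP, colLen_eq_card hP]
    have h1 : ({p ∈ P.parts.toFinset | j < p} : Finset ℕ)
        = insert m (P.parts.toFinset ∩ Ioo j m) ∪ {p ∈ P.parts.toFinset | m < p} := by
      ext p
      simp only [mem_filter, mem_union, mem_insert, mem_inter, mem_Ioo]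
      constructor
      · rintro ⟨h1, h2⟩
        rcases lt_trichotomy p m with h3 | h3 | h3 <;> simp_all
      · rintro ((rfl | h1) | h1)
        · exact ⟨hm, hj⟩
        · exact ⟨h1.1, h1.2.1⟩
        · exact ⟨h1.1, by omega⟩
    rw [h1, Finset.card_union_of_disjoint, Finset.card_insert_of_notMem (by simp)]
    rw [Finset.disjoint_left]
    intro p hp hp'
    simp only [mem_insert, mem_inter, mem_Ioo, mem_filter] at hp hp'
    omega
  apply Finset.card_bij (fun x _ => (colLen P x.2, x.1))
  · rintro ⟨j, m⟩ hx
    simp only [mem_filter, mem_product, mem_range] at hx ⊢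
    obtain ⟨⟨h1, h2⟩, h3, h4⟩ := hx
    rw [rowLen_colLen hP h2, key m h2 j h3]
    refine ⟨⟨?_, h1⟩, h3, by omega⟩
    have h5 : colLen P m ≤ P.parts.card := Multiset.card_le_card (Multiset.filter_le _ _)
    have h6 : P.parts.card ≤ n := by
      have := Multiset.card_nsmul_le_sum (s := P.parts) (a := 1) fun x hx => P.parts_pos hx
      rw [P.parts_sum] at this
      simpa using this
    omega
  · rintro ⟨j, m⟩ hx ⟨j', m'⟩ hx' heq
    simp only [mem_filter, mem_product, mem_range, Prod.mk.injEq] at hx hx' heq ⊢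
    refine ⟨heq.2, ?_⟩
    rw [← rowLen_colLen hP hx.1.2, ← rowLen_colLen hP hx'.1.2, heq.1]
  · rintro ⟨i, j⟩ hx
    simp only [mem_filter, mem_product, mem_range] at hx
    obtain ⟨⟨h1, h2⟩, h3, h4⟩ := hx
    obtain ⟨m, hm, rfl⟩ := exists_mem_colLen_eq hP h3
    rw [rowLen_colLen hP hm] at h3 h4
    refine ⟨(j, m), ?_, rfl⟩
    simp only [mem_filter, mem_product, mem_range]
    refine ⟨⟨h2, hm⟩, h3, ?_⟩
    rw [key m hm j h3] at h4
    omega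

lemma hookDistinct_eq_sum (h n : ℕ) :
    hookDistinct h n = ∑ A ∈ (Icc 1 n).powerset with ∑ k ∈ A, k = n, setHookCount h n A := by
  rw [hookDistinct, Finset.sum_congr rfl fun P hP => hookCount_eq_setHookCount hP h]
  refine Finset.sum_bij (fun P _ => P.parts.toFinset) ?_ ?_ ?_ fun _ _ => rfl
  · intro P hP
    simp only [mem_filter, mem_powerset]
    constructor
    · intro m hm
      exact mem_Icc.2 ⟨P.parts_pos (Multiset.mem_toFinset.1 hm),
        Nat.Partition.le_of_mem_parts_toFinset hm⟩
    · have := P.parts_sum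
      rw [← Nat.Partition.toFinset_val_of_mem_distincts hP] at this
      simpa [Finset.sum] using this
  · intro P hP Q hQ heq
    ext1
    rw [← Nat.Partition.toFinset_val_of_mem_distincts hP, heq,
      Nat.Partition.toFinset_val_of_mem_distincts hQ]
  · intro A hA
    simp only [mem_filter, mem_powerset] at hA
    refine ⟨⟨A.val, fun {i} hi => (mem_Icc.1 (hA.1 hi)).1, by
      have := hA.2
      rwa [Finset.sum, Multiset.map_id'] at this⟩, ?_, ?_⟩
    · simpa [Nat.Partition.distincts] using A.nodup
    · simp

/-- The pairs `(d, T)` describing a hook of length `h` of a partition into distinct parts whose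
column is `j` and whose row is the part `j + d`: the parts in `(j, j + d]` are `j + t`, `t ∈ T`. -/
def hookPatterns (h : ℕ) : Finset (ℕ × Finset ℕ) :=
  {x ∈ Icc 1 h ×ˢ (Icc 1 h).powerset | x.2 ⊆ Icc 1 x.1 ∧ x.1 ∈ x.2 ∧ #x.2 + x.1 = h + 1}

lemma mem_hookPatterns {h : ℕ} {x : ℕ × Finset ℕ} :
    x ∈ hookPatterns h ↔ x.2 ⊆ Icc 1 x.1 ∧ x.1 ∈ x.2 ∧ #x.2 + x.1 = h + 1 := by
  simp only [hookPatterns, mem_filter, mem_product, mem_powerset, and_iff_right_iff_imp, mem_Icc]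
  rintro ⟨h1, h2, h3⟩
  have h4 := mem_Icc.1 (h1 h2)
  have h5 : 0 < #x.2 := card_pos.2 ⟨_, h2⟩
  refine ⟨by omega, h1.trans (Icc_subset_Icc le_rfl (by omega))⟩

lemma setHookCount_eq_sum {h n : ℕ} {A : Finset ℕ} (hA : A ⊆ Icc 1 n) :
    setHookCount h n A = ∑ x ∈ hookPatterns h,
      #{j ∈ range (n + 1 - x.1) | A ∩ Ioc j (j + x.1) = x.2.image (j + ·)} := by
  rw [setHookCount, ← Finset.card_sigma]
  refine Finset.card_bij' (fun y _ => ⟨(y.2 - y.1, (A ∩ Ioc y.1 y.2).image (· - y.1)), y.1⟩)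
    (fun z _ => (z.2, z.2 + z.1.1)) ?_ ?_ ?_ ?_
  · rintro ⟨j, m⟩ hy
    simp only [mem_filter, mem_product, mem_range] at hy
    simp only [mem_sigma, mem_hookPatterns, mem_filter, mem_range]
    obtain ⟨⟨h1, h2⟩, h3, h4⟩ := hy
    have h5 := mem_Icc.1 (hA h2)
    have h6 : A ∩ Ioc j m = insert m (A ∩ Ioo j m) := by
      ext p
      simp only [mem_inter, mem_Ioc, mem_insert, mem_Ioo]
      constructor
      · rintro ⟨h7, h8⟩
        by_cases h9 : p = m
        · exact Or.inl h9
        · exact Or.inr ⟨h7, by omega⟩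
      · rintro (rfl | h7)
        · exact ⟨h2, by omega⟩
        · exact ⟨h7.1, by omega⟩
    refine ⟨⟨?_, ?_, ?_⟩, by omega, ?_⟩
    · intro t ht
      simp only [mem_image, mem_inter, mem_Ioc] at ht
      obtain ⟨p, hp, rfl⟩ := ht
      rw [mem_Icc]
      omega
    · exact mem_image.2 ⟨m, by simp only [mem_inter, mem_Ioc]; exact ⟨h2, by omega⟩, rfl⟩
    · rw [card_image_of_injOn, h6, card_insert_of_notMem (by simp)]
      · omega
      · intro p hp q hq hpq
        simp only [coe_inter, Set.mem_inter_iff, mem_coe, mem_Ioc] at hp hq hpq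
        omega
    · rw [Nat.add_sub_cancel' h3.le, image_image]
      symm
      refine Eq.trans (image_congr (g := id) ?_) Finset.image_id
      intro p hp
      simp only [coe_inter, Set.mem_inter_iff, mem_coe, mem_Ioc] at hp
      simp only [Function.comp, id]
      omega
  · rintro ⟨⟨d, T⟩, j⟩ hz
    simp only [mem_sigma, mem_hookPatterns, mem_filter, mem_range] at hz
    obtain ⟨⟨h1, h2, h3⟩, h4, h5⟩ := hz
    have h6 := mem_Icc.1 (h1 h2)
    simp only [mem_filter, mem_product, mem_range]
    have h7 : A ∩ Ioc j (j + d) = insert (j + d) (A ∩ Ioo j (j + d)) := by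
      ext p
      simp only [mem_inter, mem_Ioc, mem_insert, mem_Ioo]
      have h8 : j + d ∈ A := by
        have : j + d ∈ A ∩ Ioc j (j + d) := by rw [h5]; exact mem_image.2 ⟨d, h2, rfl⟩
        exact (mem_inter.1 this).1
      constructor
      · rintro ⟨h7, h8⟩
        by_cases h9 : p = j + d
        · exact Or.inl h9
        · exact Or.inr ⟨h7, by omega⟩
      · rintro (rfl | h7)
        · exact ⟨h8, by omega⟩
        · exact ⟨h7.1, by omega⟩
    have h8 : #(A ∩ Ioc j (j + d)) = #T := by
      rw [h5, card_image_of_injective _ (add_right_injective j)]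
    have h9 : j + d ∈ A := by
      have : j + d ∈ A ∩ Ioc j (j + d) := by rw [h7]; exact mem_insert_self _ _
      exact (mem_inter.1 this).1
    rw [h7, card_insert_of_notMem (by simp)] at h8
    refine ⟨⟨by omega, h9⟩, by omega, by omega⟩
  · rintro ⟨j, m⟩ hy
    simp only [mem_filter, mem_product, mem_range] at hy
    simp only [Prod.mk.injEq, true_and]
    omega
  · rintro ⟨⟨d, T⟩, j⟩ hz
    simp only [mem_sigma, mem_hookPatterns, mem_filter, mem_range] at hz
    obtain ⟨-, -, h5⟩ := hz
    have h6 : (A ∩ Ioc j (j + d)).image (· - j) = T := by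
      rw [h5, image_image]
      convert Finset.image_id using 1
      apply image_congr
      intro p _
      simp
    simp [h6]

lemma sum_pow_of_inter_eq {n d j : ℕ} {T : Finset ℕ} (hT : T ⊆ Icc 1 d) (hj : j + d ≤ n) (z : ℂ) :
    ∑ A ∈ (Icc 1 n).powerset with A ∩ Ioc j (j + d) = T.image (j + ·), z ^ (∑ k ∈ A, k)
      = z ^ (∑ t ∈ T, t + j * #T) * ∏ k ∈ Icc 1 n \ Ioc j (j + d), (1 + z ^ k) := by
  have hsum : ∑ k ∈ T.image (j + ·), k = ∑ t ∈ T, t + j * #T := by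
    rw [Finset.sum_image fun _ _ _ _ h => add_right_injective j h, Finset.sum_add_distrib]
    simp [mul_comm, add_comm]
  have hTW : T.image (j + ·) ⊆ Ioc j (j + d) := by
    intro p hp
    obtain ⟨t, ht, rfl⟩ := mem_image.1 hp
    have := mem_Icc.1 (hT ht)
    rw [mem_Ioc]
    omega
  have hW : Ioc j (j + d) ⊆ Icc 1 n := by
    intro p hp
    rw [mem_Ioc] at hp
    rw [mem_Icc]
    omega
  set W := Ioc j (j + d)
  set B := T.image (j + ·)
  rw [Finset.prod_one_add, Finset.mul_sum, ← hsum]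
  refine Finset.sum_bij' (fun A _ => A \ W) (fun C _ => B ∪ C) ?_ ?_ ?_ ?_ ?_
  · intro A hA
    simp only [mem_filter, mem_powerset] at hA ⊢
    exact sdiff_subset_sdiff hA.1 le_rfl
  · intro C hC
    simp only [mem_filter, mem_powerset] at hC ⊢
    have hCW : C ∩ W = ∅ := by
      rw [← disjoint_iff_inter_eq_empty]
      exact disjoint_of_subset_left hC sdiff_disjoint
    refine ⟨union_subset (hTW.trans hW) (hC.trans sdiff_subset), ?_⟩
    rw [union_inter_distrib_right, hCW, union_empty, inter_eq_left.2 hTW]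
  · intro A hA
    simp only [mem_filter, mem_powerset] at hA
    rw [← hA.2, union_comm]
    exact sdiff_union_inter A W
  · intro C hC
    simp only [mem_powerset] at hC
    have hCW : Disjoint C W := disjoint_of_subset_left hC sdiff_disjoint
    rw [union_sdiff_distrib, sdiff_eq_empty_iff_subset.2 hTW, empty_union,
      sdiff_eq_self_of_disjoint hCW]
  · intro A hA
    simp only [mem_filter, mem_powerset] at hA
    rw [Finset.prod_pow_eq_pow_sum, ← pow_add, ← hA.2, add_comm, ← Finset.sum_union]
    · rw [sdiff_union_inter]
    · exact disjoint_of_subset_right inter_subset_right sdiff_disjoint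

/-- The generating polynomial of `setHookCount`, over the sets of parts of size at most `n`. -/
lemma sum_setHookCount_mul_pow (h n : ℕ) (z : ℂ) :
    ∑ A ∈ (Icc 1 n).powerset, (setHookCount h n A : ℂ) * z ^ (∑ k ∈ A, k)
      = ∑ x ∈ hookPatterns h, ∑ j ∈ range (n + 1 - x.1),
        z ^ (∑ t ∈ x.2, t + j * #x.2) * ∏ k ∈ Icc 1 n \ Ioc j (j + x.1), (1 + z ^ k) := by
  have h1 : ∀ A ∈ (Icc 1 n).powerset, (setHookCount h n A : ℂ) * z ^ (∑ k ∈ A, k)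
      = ∑ x ∈ hookPatterns h, ∑ j ∈ range (n + 1 - x.1),
        if A ∩ Ioc j (j + x.1) = x.2.image (j + ·) then z ^ (∑ k ∈ A, k) else 0 := by
    intro A hA
    rw [setHookCount_eq_sum (mem_powerset.1 hA)]
    push_cast
    rw [Finset.sum_mul]
    refine Finset.sum_congr rfl fun x _ => ?_
    rw [← Finset.sum_filter, Finset.sum_const, nsmul_eq_mul]
  rw [Finset.sum_congr rfl h1, Finset.sum_comm]
  refine Finset.sum_congr rfl fun x hx => ?_
  rw [Finset.sum_comm]
  refine Finset.sum_congr rfl fun j hj => ?_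
  rw [mem_hookPatterns] at hx
  rw [mem_range] at hj
  rw [← Finset.sum_filter, sum_pow_of_inter_eq hx.1 (by omega)]

/-- The point of modulus `exp (-ε)` and argument `θ`. -/
noncomputable def circlePt (ε θ : ℝ) : ℂ := Complex.exp (-ε + θ * Complex.I)

/-- The normalised generating product of partitions into distinct parts of size at most `n`, that
is, the characteristic function of the size of a random partition, centred at `n`. -/
noncomputable def distinctChar (n : ℕ) (ε θ : ℝ) : ℂ :=
  Complex.exp (-(n * θ * Complex.I)) *
    ∏ k ∈ Icc 1 n, (1 + circlePt ε θ ^ k) / (1 + Real.exp (-ε * k))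

/-- The quotient of the generating function of hooks of length `h` by that of partitions. -/
noncomputable def hookRatio (h n : ℕ) (ε θ : ℝ) : ℂ :=
  ∑ x ∈ hookPatterns h, ∑ j ∈ range (n + 1 - x.1),
    circlePt ε θ ^ (∑ t ∈ x.2, t + j * #x.2) / ∏ k ∈ Ioc j (j + x.1), (1 + circlePt ε θ ^ k)

lemma norm_circlePt (ε θ : ℝ) : ‖circlePt ε θ‖ = Real.exp (-ε) := by
  simp [circlePt, Complex.norm_exp]

lemma norm_circlePt_pow (ε θ : ℝ) (k : ℕ) : ‖circlePt ε θ ^ k‖ = Real.exp (-ε * k) := by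
  rw [norm_pow, norm_circlePt, ← Real.exp_nat_mul, mul_comm]

lemma circlePt_pow (ε θ : ℝ) (k : ℕ) :
    circlePt ε θ ^ k = Complex.exp (k * (-ε + θ * Complex.I)) := by
  rw [circlePt, ← Complex.exp_nat_mul]

lemma one_add_circlePt_pow_ne_zero {ε : ℝ} (hε : 0 < ε) (θ : ℝ) {k : ℕ} (hk : 1 ≤ k) :
    1 + circlePt ε θ ^ k ≠ 0 := by
  intro h
  have h1 : ‖circlePt ε θ ^ k‖ = 1 := by
    rw [eq_neg_of_add_eq_zero_right h, norm_neg, norm_one]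
  rw [norm_circlePt_pow, Real.exp_eq_one_iff] at h1
  have : (0 : ℝ) < k := by exact_mod_cast hk
  nlinarith

lemma integral_exp_int_mul_I (m : ℤ) :
    ∫ θ in (-Real.pi)..Real.pi, Complex.exp (m * Complex.I * θ)
      = if m = 0 then (2 * Real.pi : ℂ) else 0 := by
  split_ifs with hm
  · simp [hm]
    ring
  · have hc : (m : ℂ) * Complex.I ≠ 0 := by simp [hm]
    rw [integral_exp_mul_complex hc, div_eq_zero_iff]
    left
    rw [sub_eq_zero, Complex.exp_eq_exp_iff_exists_int]
    refine ⟨m, ?_⟩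
    push_cast
    ring

lemma integral_sum_pow_circlePt {ι : Type*} (s : Finset ι) (w : ι → ℂ) (e : ι → ℕ) (n : ℕ)
    (ε : ℝ) :
    ∫ θ in (-Real.pi)..Real.pi, Complex.exp (-(n * θ * Complex.I)) *
        ∑ A ∈ s, w A * circlePt ε θ ^ e A
      = 2 * Real.pi * Real.exp (-ε * n) * ∑ A ∈ s with e A = n, w A := by
  have h1 : ∀ θ : ℝ, Complex.exp (-(n * θ * Complex.I)) * ∑ A ∈ s, w A * circlePt ε θ ^ e A
      = ∑ A ∈ s, (w A * Real.exp (-ε * e A)) *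
        Complex.exp (((e A - n : ℤ) : ℂ) * Complex.I * θ) := by
    intro θ
    rw [Finset.mul_sum]
    refine Finset.sum_congr rfl fun A _ => ?_
    rw [circlePt_pow, mul_left_comm, mul_assoc, Complex.ofReal_exp, ← Complex.exp_add,
      mul_assoc, ← Complex.exp_add]
    congr 2
    push_cast
    ring
  simp_rw [h1]
  rw [intervalIntegral.integral_finsetSum]
  · simp_rw [intervalIntegral.integral_const_mul, integral_exp_int_mul_I]
    rw [Finset.mul_sum, Finset.sum_filter]
    refine Finset.sum_congr rfl fun A _ => ?_
    have : ((e A : ℤ) - n = 0) ↔ e A = n := by omega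
    by_cases h : e A = n
    · rw [if_pos (this.2 h), if_pos h, h]
      ring
    · simp [this, h]
  · intro A _
    apply Continuous.intervalIntegrable
    fun_prop

lemma distinctChar_mul_hookRatio (h n : ℕ) {ε : ℝ} (hε : 0 < ε) (θ : ℝ) :
    distinctChar n ε θ * hookRatio h n ε θ * ∏ k ∈ Icc 1 n, (1 + Real.exp (-ε * k) : ℂ)
      = Complex.exp (-(n * θ * Complex.I)) *
        ∑ A ∈ (Icc 1 n).powerset, (setHookCount h n A : ℂ) * circlePt ε θ ^ (∑ k ∈ A, k) := by
  have hne : ∏ k ∈ Icc 1 n, (1 + Real.exp (-ε * k) : ℂ) ≠ 0 := by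
    rw [Finset.prod_ne_zero_iff]
    intro k _
    have : (0 : ℝ) < 1 + Real.exp (-ε * k) := by positivity
    exact_mod_cast this.ne'
  rw [sum_setHookCount_mul_pow, distinctChar, Finset.prod_div_distrib, hookRatio]
  rw [mul_assoc, mul_assoc, mul_comm _ (∏ k ∈ Icc 1 n, (1 + Real.exp (-ε * k) : ℂ)), ← mul_assoc
    (_ / _), div_mul_cancel₀ _ hne, Finset.mul_sum]
  congr 1
  refine Finset.sum_congr rfl fun x hx => ?_
  rw [Finset.mul_sum]
  refine Finset.sum_congr rfl fun j hj => ?_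
  rw [mem_range] at hj
  have hW : Ioc j (j + x.1) ⊆ Icc 1 n := by
    intro p hp
    rw [mem_Ioc] at hp
    rw [mem_Icc]
    omega
  have hW0 : ∏ k ∈ Ioc j (j + x.1), (1 + circlePt ε θ ^ k) ≠ 0 := by
    rw [Finset.prod_ne_zero_iff]
    intro k hk
    exact one_add_circlePt_pow_ne_zero hε θ (mem_Icc.1 (hW hk)).1
  rw [← Finset.prod_sdiff hW]
  field_simp

/-- The hook count as a Fourier coefficient. -/
lemma hookDistinct_eq_integral (h n : ℕ) {ε : ℝ} (hε : 0 < ε) :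
    (hookDistinct h n : ℂ) = Real.exp (ε * n) * (∏ k ∈ Icc 1 n, (1 + Real.exp (-ε * k))) /
      (2 * Real.pi) * ∫ θ in (-Real.pi)..Real.pi, distinctChar n ε θ * hookRatio h n ε θ := by
  have h1 := integral_sum_pow_circlePt (Icc 1 n).powerset
    (fun A => (setHookCount h n A : ℂ)) (fun A => ∑ k ∈ A, k) n ε
  simp_rw [← distinctChar_mul_hookRatio h n hε] at h1
  rw [intervalIntegral.integral_mul_const] at h1
  have h2 : (Real.exp (ε * n) : ℂ) * Real.exp (-ε * n) = 1 := by
    rw [← Complex.ofReal_mul, ← Real.exp_add]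
    simp
  rw [hookDistinct_eq_sum]
  have hpi : (Real.pi : ℂ) ≠ 0 := by exact_mod_cast Real.pi_ne_zero
  push_cast at h1 h2 ⊢
  simp only [neg_mul] at h1 h2 ⊢
  field_simp
  linear_combination (-Complex.exp (ε * n)) * h1 - 2 * Real.pi *
    (∑ A ∈ (Icc 1 n).powerset with ∑ k ∈ A, k = n, (setHookCount h n A : ℂ)) * h2

/-- `p ^ s * (1 - p) ^ (d - s)` for the occupation probability `p = 1 / (1 + exp x)`. -/
noncomputable def hookDensity (s d : ℕ) (x : ℝ) : ℝ := Real.exp (-x) ^ s / (1 + Real.exp (-x)) ^ d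

/-- The constant in the asymptotic formula for the number of hooks of length `h`. -/
noncomputable def hookConst (h : ℕ) : ℝ :=
  ∑ x ∈ hookPatterns h, ∫ u in Set.Ioi (0 : ℝ), hookDensity #x.2 x.1 u

/-- The limiting probability that a part is present. -/
noncomputable def fermi (x : ℝ) : ℝ := Real.exp (-x) / (1 + Real.exp (-x))

lemma fermi_pos (x : ℝ) : 0 < fermi x := by unfold fermi; positivity

lemma fermi_lt_one (x : ℝ) : fermi x < 1 := by
  unfold fermi
  rw [div_lt_one (by positivity)]
  linarith

lemma fermi_le_exp (x : ℝ) : fermi x ≤ Real.exp (-x) :=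
  div_le_self (Real.exp_pos _).le (by linarith [Real.exp_pos (-x)])

lemma one_sub_fermi (x : ℝ) : 1 - fermi x = 1 / (1 + Real.exp (-x)) := by
  unfold fermi
  field_simp
  ring

@[fun_prop]
lemma continuous_fermi : Continuous fermi := by
  unfold fermi
  exact Continuous.div (by fun_prop) (by fun_prop) fun x => by positivity

lemma hasDerivAt_fermi (x : ℝ) : HasDerivAt fermi (-(fermi x * (1 - fermi x))) x := by
  have h1 : HasDerivAt (fun x : ℝ => Real.exp (-x)) (-Real.exp (-x)) x := by
    simpa using (hasDerivAt_neg x).exp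
  have h2 := h1.div (h1.const_add 1) (by positivity)
  refine h2.congr_deriv ?_
  rw [one_sub_fermi, fermi]
  field_simp
  ring

lemma tendsto_fermi_atTop : Filter.Tendsto fermi Filter.atTop (nhds 0) :=
  squeeze_zero (fun x => (fermi_pos x).le) fermi_le_exp
    (Real.tendsto_exp_atBot.comp Filter.tendsto_neg_atTop_atBot)

lemma hookDensity_pos (s d : ℕ) (x : ℝ) : 0 < hookDensity s d x := by
  unfold hookDensity; positivity

lemma hookDensity_le {s d : ℕ} (hs : 1 ≤ s) {x : ℝ} (hx : 0 ≤ x) :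
    hookDensity s d x ≤ Real.exp (-x) := by
  have h1 : Real.exp (-x) ≤ 1 := by simpa using hx
  have h2 : 0 ≤ Real.exp (-x) := (Real.exp_pos _).le
  exact (div_le_self (by positivity) (one_le_pow₀ (by linarith))).trans
    (pow_le_of_le_one h2 h1 (by omega))

@[fun_prop]
lemma continuous_hookDensity (s d : ℕ) : Continuous (hookDensity s d) := by
  unfold hookDensity
  exact Continuous.div (by fun_prop) (by fun_prop) fun x => by positivity

lemma integrableOn_hookDensity {s d : ℕ} (hs : 1 ≤ s) :
    MeasureTheory.IntegrableOn (hookDensity s d) (Set.Ioi 0) := by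
  refine MeasureTheory.Integrable.mono' (integrableOn_exp_neg_Ioi 0)
    (continuous_hookDensity s d).aestronglyMeasurable ?_
  filter_upwards [MeasureTheory.ae_restrict_mem measurableSet_Ioi] with x hx
  rw [Real.norm_eq_abs, abs_of_pos (hookDensity_pos s d x)]
  exact hookDensity_le hs (le_of_lt hx)

lemma integral_hookDensity_pos {s d : ℕ} (hs : 1 ≤ s) :
    0 < ∫ u in Set.Ioi (0 : ℝ), hookDensity s d u := by
  rw [MeasureTheory.setIntegral_pos_iff_support_of_nonneg_ae
    (Filter.Eventually.of_forall fun x => (hookDensity_pos s d x).le) (integrableOn_hookDensity hs)]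
  have : Function.support (hookDensity s d) = Set.univ := by
    ext x
    simp [(hookDensity_pos s d x).ne']
  rw [this, Set.univ_inter]
  simp

lemma integrableOn_fermi : MeasureTheory.IntegrableOn fermi (Set.Ioi 0) := by
  have : fermi = hookDensity 1 1 := by
    ext x
    simp [fermi, hookDensity]
  rw [this]
  exact integrableOn_hookDensity le_rfl

lemma integral_fermi : ∫ x in Set.Ioi (0 : ℝ), fermi x = Real.log 2 := by
  have h1 : ∀ x ∈ Set.Ici (0 : ℝ),
      HasDerivAt (fun x : ℝ => -Real.log (1 + Real.exp (-x))) (fermi x) x := by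
    intro x _
    have h1 : HasDerivAt (fun x : ℝ => Real.exp (-x)) (-Real.exp (-x)) x := by
      simpa using (hasDerivAt_neg x).exp
    have h2 := ((h1.const_add 1).log (by positivity)).neg
    refine h2.congr_deriv ?_
    rw [fermi]
    ring
  have hlim : Filter.Tendsto (fun x : ℝ => -Real.log (1 + Real.exp (-x))) Filter.atTop
      (nhds (-Real.log (1 + 0))) := by
    refine Filter.Tendsto.neg (Filter.Tendsto.log ?_ (by norm_num))
    exact (Real.tendsto_exp_atBot.comp Filter.tendsto_neg_atTop_atBot).const_add 1
  rw [MeasureTheory.integral_Ioi_of_hasDerivAt_of_tendsto' h1 integrableOn_fermi hlim]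
  norm_num

lemma integrableOn_eval_fermi (Q : Polynomial ℚ) :
    MeasureTheory.IntegrableOn (fun x => Polynomial.aeval (fermi x) Q * (fermi x * (1 - fermi x)))
      (Set.Ioi 0) := by
  have hQ : Continuous fun y : ℝ => Polynomial.aeval y Q := Polynomial.continuous_aeval Q
  obtain ⟨C, hC⟩ := (isCompact_Icc (a := (0 : ℝ)) (b := 1)).exists_bound_of_continuousOn
    hQ.continuousOn
  refine MeasureTheory.Integrable.bdd_mul (c := C) ?_ ?_ ?_
  · have : (fun x => fermi x * (1 - fermi x)) = hookDensity 1 2 := by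
      ext x
      rw [one_sub_fermi, fermi, hookDensity]
      field_simp
    rw [this]
    exact integrableOn_hookDensity le_rfl
  · exact (hQ.comp continuous_fermi).aestronglyMeasurable
  · exact Filter.Eventually.of_forall fun x => hC _ ⟨(fermi_pos x).le, (fermi_lt_one x).le⟩

lemma exists_rat_integral_eval_fermi (Q : Polynomial ℚ) :
    ∃ r : ℚ, ∫ x in Set.Ioi (0 : ℝ), Polynomial.aeval (fermi x) Q * (fermi x * (1 - fermi x))
      = r := by
  induction Q using Polynomial.induction_on' with
  | add P Q hP hQ =>
    obtain ⟨r, hr⟩ := hP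
    obtain ⟨s, hs⟩ := hQ
    refine ⟨r + s, ?_⟩
    rw [Rat.cast_add, ← hr, ← hs, ← MeasureTheory.integral_add (integrableOn_eval_fermi P)
      (integrableOn_eval_fermi Q)]
    simp [add_mul]
  | monomial m a =>
    refine ⟨a * (1 / 2) ^ (m + 1) / (m + 1), ?_⟩
    have h1 : ∀ x ∈ Set.Ici (0 : ℝ), HasDerivAt (fun x => -(a / (m + 1) * fermi x ^ (m + 1)))
        (Polynomial.aeval (fermi x) (Polynomial.monomial m a) * (fermi x * (1 - fermi x))) x := by
      intro x _
      have h2 := (((hasDerivAt_fermi x).pow (m + 1)).const_mul ((a : ℝ) / (m + 1))).neg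
      refine h2.congr_deriv ?_
      rw [Polynomial.aeval_monomial]
      have : ((m : ℝ) + 1) ≠ 0 := by positivity
      simp
      field_simp
    have hlim : Filter.Tendsto (fun x => -(a / (m + 1) * fermi x ^ (m + 1))) Filter.atTop
        (nhds (-((a : ℝ) / (m + 1) * 0 ^ (m + 1)))) :=
      ((tendsto_fermi_atTop.pow (m + 1)).const_mul _).neg
    rw [MeasureTheory.integral_Ioi_of_hasDerivAt_of_tendsto' h1 (integrableOn_eval_fermi _) hlim]
    have : fermi 0 = 1 / 2 := by norm_num [fermi]
    rw [this]
    push_cast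
    simp
    ring

lemma hookDensity_eq_fermi {s d : ℕ} (hsd : s ≤ d) (x : ℝ) :
    hookDensity s d x = fermi x ^ s * (1 - fermi x) ^ (d - s) := by
  obtain ⟨e, rfl⟩ := Nat.exists_eq_add_of_le hsd
  rw [one_sub_fermi, fermi, hookDensity, Nat.add_sub_cancel_left, pow_add, div_pow, div_pow,
    one_pow]
  field_simp

lemma exists_rat_integral_hookDensity_of_lt {s d : ℕ} (hs : 1 ≤ s) (hsd : s < d) :
    ∃ r : ℚ, ∫ u in Set.Ioi (0 : ℝ), hookDensity s d u = r := by
  obtain ⟨r, hr⟩ := exists_rat_integral_eval_fermi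
    (Polynomial.X ^ (s - 1) * (1 - Polynomial.X) ^ (d - s - 1))
  refine ⟨r, ?_⟩
  rw [← hr]
  congr 1
  ext x
  rw [hookDensity_eq_fermi hsd.le]
  obtain ⟨s, rfl⟩ := Nat.exists_eq_add_of_le' hs
  obtain ⟨e, rfl⟩ := Nat.exists_eq_add_of_lt hsd
  have h1 : s + 1 + e + 1 - (s + 1) = e + 1 := by omega
  simp [h1]
  ring

lemma exists_rat_integral_hookDensity_self {d : ℕ} (hd : 1 ≤ d) :
    ∃ r : ℚ, ∫ u in Set.Ioi (0 : ℝ), hookDensity d d u = r + Real.log 2 := by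
  obtain ⟨r, hr⟩ := exists_rat_integral_eval_fermi
    (∑ i ∈ range (d - 1), Polynomial.X ^ i)
  refine ⟨-r, ?_⟩
  push_cast
  rw [← hr, ← integral_fermi, neg_add_eq_sub,
    ← MeasureTheory.integral_sub integrableOn_fermi (integrableOn_eval_fermi _)]
  congr 1
  ext x
  obtain ⟨d, rfl⟩ := Nat.exists_eq_add_of_le' hd
  rw [hookDensity_eq_fermi le_rfl]
  have h1 := mul_geom_sum (fermi x) d
  simp only [Nat.add_sub_cancel, map_sum, map_pow, Polynomial.aeval_X, Nat.sub_self, pow_zero,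
    mul_one]
  rw [pow_succ]
  linear_combination -fermi x * h1

lemma one_le_card_of_mem_hookPatterns {h : ℕ} {x : ℕ × Finset ℕ} (hx : x ∈ hookPatterns h) :
    1 ≤ #x.2 :=
  card_pos.2 ⟨_, (mem_hookPatterns.1 hx).2.1⟩

lemma hookConst_pos {h : ℕ} (hh : 1 ≤ h) : 0 < hookConst h := by
  refine Finset.sum_pos (fun x hx => integral_hookDensity_pos (one_le_card_of_mem_hookPatterns hx))
    ⟨(h, {h}), mem_hookPatterns.2 ⟨?_, ?_, ?_⟩⟩
  · simpa using hh
  · simp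
  · simp [add_comm]

lemma card_le_of_mem_hookPatterns {h : ℕ} {x : ℕ × Finset ℕ} (hx : x ∈ hookPatterns h) :
    #x.2 ≤ x.1 := by
  simpa using Finset.card_le_card (mem_hookPatterns.1 hx).1

lemma exists_rat_sum_integral_hookDensity {h : ℕ} {s : Finset (ℕ × Finset ℕ)}
    (hs : s ⊆ hookPatterns h) (hlt : ∀ x ∈ s, #x.2 < x.1) :
    ∃ r : ℚ, ∑ x ∈ s, ∫ u in Set.Ioi (0 : ℝ), hookDensity #x.2 x.1 u = r := by
  have h1 : ∀ x : ℕ × Finset ℕ, ∃ r : ℚ, x ∈ s →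
      ∫ u in Set.Ioi (0 : ℝ), hookDensity #x.2 x.1 u = r := by
    intro x
    by_cases hx : x ∈ s
    · obtain ⟨r, hr⟩ := exists_rat_integral_hookDensity_of_lt
        (one_le_card_of_mem_hookPatterns (hs hx)) (hlt x hx)
      exact ⟨r, fun _ => hr⟩
    · exact ⟨0, fun h => absurd h hx⟩
  choose r hr using h1
  refine ⟨∑ x ∈ s, r x, ?_⟩
  push_cast
  exact Finset.sum_congr rfl fun x hx => hr x hx

lemma exists_rat_hookConst_of_even {h : ℕ} (hh : Even h) : ∃ r : ℚ, hookConst h = r := by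
  refine exists_rat_sum_integral_hookDensity subset_rfl fun x hx => ?_
  have h1 := card_le_of_mem_hookPatterns hx
  have h2 := (mem_hookPatterns.1 hx).2.2
  obtain ⟨k, rfl⟩ := hh
  omega

lemma exists_rat_hookConst_of_odd {h : ℕ} (hh : Odd h) :
    ∃ r : ℚ, hookConst h = r + Real.log 2 := by
  obtain ⟨k, rfl⟩ := hh
  have hmem : (k + 1, Icc 1 (k + 1)) ∈ hookPatterns (2 * k + 1) := by
    rw [mem_hookPatterns]
    simp
    omega
  obtain ⟨r, hr⟩ := exists_rat_sum_integral_hookDensity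
    (s := (hookPatterns (2 * k + 1)).erase (k + 1, Icc 1 (k + 1))) (erase_subset _ _) (by
      rintro ⟨d, T⟩ hx
      obtain ⟨h0, hx⟩ := mem_erase.1 hx
      refine lt_of_le_of_ne (card_le_of_mem_hookPatterns hx) fun heq => h0 ?_
      obtain ⟨h1, h2, h3⟩ := mem_hookPatterns.1 hx
      simp only at heq h1 h3
      have hd : d = k + 1 := by omega
      subst hd
      rw [Finset.eq_of_subset_of_card_le h1 (by simp [heq])])
  obtain ⟨q, hq⟩ := exists_rat_integral_hookDensity_self (d := k + 1) (by omega)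
  refine ⟨q + r, ?_⟩
  rw [hookConst, ← Finset.add_sum_erase _ _ hmem, hr]
  simp only [Nat.card_Icc, Nat.add_sub_cancel]
  rw [hq]
  push_cast
  ring

lemma exists_rat_hookConst (h : ℕ) :
    ∃ r s : ℚ, hookConst h = (r : ℝ) + (s : ℝ) * Real.log 2 := by
  rcases Nat.even_or_odd h with hh | hh
  · obtain ⟨r, hr⟩ := exists_rat_hookConst_of_even hh
    exact ⟨r, 0, by simp [hr]⟩
  · obtain ⟨r, hr⟩ := exists_rat_hookConst_of_odd hh
    exact ⟨r, 1, by simp [hr]⟩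

lemma hookConst_rat_iff (h : ℕ) : (∃ r : ℚ, hookConst h = (r : ℝ)) ↔ Even h := by
  refine ⟨?_, exists_rat_hookConst_of_even⟩
  rintro ⟨r, hr⟩
  by_contra hh
  obtain ⟨q, hq⟩ := exists_rat_hookConst_of_odd (Nat.not_even_iff_odd.1 hh)
  refine irrational_log_two ⟨r - q, ?_⟩
  push_cast
  linarith

/-- The saddle point: the size of a random partition into distinct parts in which the part `k` is
present with probability `1 / (1 + exp (ε * k))` is about `π ^ 2 / (12 * ε ^ 2)`. -/
noncomputable def saddle (n : ℕ) : ℝ := Real.pi / Real.sqrt (12 * n)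

lemma saddle_pos {n : ℕ} (hn : 1 ≤ n) : 0 < saddle n := by
  have : (0 : ℝ) < n := by exact_mod_cast hn
  unfold saddle
  positivity

lemma eventually_saddle_pos : ∀ᶠ n in Filter.atTop, 0 < saddle n :=
  Filter.eventually_atTop.2 ⟨1, fun _ => saddle_pos⟩

lemma natCast_mul_saddle_sq {n : ℕ} (hn : 1 ≤ n) : n * saddle n ^ 2 = Real.pi ^ 2 / 12 := by
  have : (0 : ℝ) < n := by exact_mod_cast hn
  rw [saddle, div_pow, Real.sq_sqrt (by positivity)]
  field_simp

lemma natCast_mul_saddle {n : ℕ} (hn : 1 ≤ n) : n * saddle n = Real.pi ^ 2 / 12 * (saddle n)⁻¹ := by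
  rw [← natCast_mul_saddle_sq hn]
  have := (saddle_pos hn).ne'
  field_simp

lemma tendsto_saddle : Filter.Tendsto saddle Filter.atTop (nhds 0) := by
  refine Filter.Tendsto.const_div_atTop ?_ _
  refine Real.tendsto_sqrt_atTop.comp ?_
  exact tendsto_natCast_atTop_atTop.const_mul_atTop (by norm_num)

lemma tendsto_saddle_inv : Filter.Tendsto (fun n => (saddle n)⁻¹) Filter.atTop Filter.atTop :=
  Filter.Tendsto.inv_tendsto_nhdsGT_zero
    (tendsto_nhdsWithin_iff.2 ⟨tendsto_saddle, eventually_saddle_pos⟩)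

lemma tendsto_natCast_mul_saddle :
    Filter.Tendsto (fun n : ℕ => n * saddle n) Filter.atTop Filter.atTop := by
  refine (tendsto_saddle_inv.const_mul_atTop (r := Real.pi ^ 2 / 12) (by positivity)).congr' ?_
  filter_upwards [Filter.eventually_ge_atTop 1] with n hn
  rw [natCast_mul_saddle hn]

lemma tendsto_saddle_inv_mul_exp {c : ℝ} (hc : 0 < c) :
    Filter.Tendsto (fun n : ℕ => (saddle n)⁻¹ * Real.exp (-c * (n * saddle n))) Filter.atTop
      (nhds 0) := by
  have h1 : 0 < c * (Real.pi ^ 2 / 12) := by positivity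
  have h2 := (Real.tendsto_pow_mul_exp_neg_atTop_nhds_zero 1).comp
    (tendsto_saddle_inv.const_mul_atTop h1)
  have h3 := h2.const_mul (c * (Real.pi ^ 2 / 12))⁻¹
  rw [mul_zero] at h3
  refine h3.congr' ?_
  filter_upwards [Filter.eventually_ge_atTop 1] with n hn
  rw [natCast_mul_saddle hn]
  simp only [Function.comp, pow_one]
  rw [← mul_assoc, ← mul_assoc, inv_mul_cancel₀ h1.ne', one_mul]
  ring_nf

lemma smul_sum_range_eq_integral {E : Type*} [NormedAddCommGroup E] [NormedSpace ℝ E]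
    [CompleteSpace E] {ε : ℝ} (hε : 0 < ε) (N : ℕ) (a : ℕ → E) :
    ε • ∑ j ∈ range N, a j
      = ∫ x in Set.Ioi (0 : ℝ), if ⌊x / ε⌋₊ < N then a ⌊x / ε⌋₊ else 0 := by
  have h1 : ∀ x ∈ Set.Ici (0 : ℝ), (if ⌊x / ε⌋₊ < N then a ⌊x / ε⌋₊ else 0)
      = ∑ j ∈ range N, (Set.Ico (j * ε) ((j + 1) * ε)).indicator (fun _ => a j) x := by
    intro x hx
    have h2 : ∀ j : ℕ, x ∈ Set.Ico (j * ε) ((j + 1) * ε) ↔ j = ⌊x / ε⌋₊ := by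
      intro j
      rw [eq_comm, Nat.floor_eq_iff (by have : 0 ≤ x := hx; positivity), Set.mem_Ico,
        le_div_iff₀ hε, div_lt_iff₀ hε]
    simp_rw [Set.indicator_apply, h2]
    rw [Finset.sum_ite_eq']
    simp
  rw [← MeasureTheory.integral_Ici_eq_integral_Ioi,
    MeasureTheory.setIntegral_congr_fun measurableSet_Ici h1, MeasureTheory.integral_finsetSum]
  · rw [Finset.smul_sum]
    refine Finset.sum_congr rfl fun j _ => ?_
    rw [MeasureTheory.setIntegral_indicator measurableSet_Ico, Set.inter_eq_right.2 ?_,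
      MeasureTheory.setIntegral_const, Real.volume_real_Ico_of_le (by nlinarith)]
    · ring_nf
    · intro x hx
      exact le_trans (by positivity) hx.1
  · intro j _
    refine MeasureTheory.Integrable.integrableOn ?_
    rw [MeasureTheory.integrable_indicator_iff measurableSet_Ico]
    exact MeasureTheory.integrableOn_const (by simp)

/-- A dominated convergence theorem for Riemann sums of mesh `ε n`. -/
lemma tendsto_smul_sum_range {E : Type*} [NormedAddCommGroup E] [NormedSpace ℝ E]
    [CompleteSpace E] {ε : ℕ → ℝ} (hε : ∀ᶠ n in Filter.atTop, 0 < ε n)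
    (hε0 : Filter.Tendsto ε Filter.atTop (nhds 0)) (N : ℕ → ℕ) (a : ℕ → ℕ → E) (g : ℝ → E)
    {C c : ℝ} (hc : 0 < c)
    (hbound : ∀ᶠ n in Filter.atTop, ∀ j < N n, ‖a n j‖ ≤ C * Real.exp (-c * (ε n * j)))
    (hlim : ∀ x > 0, Filter.Tendsto (fun n => a n ⌊x / ε n⌋₊) Filter.atTop (nhds (g x)))
    (hN : Filter.Tendsto (fun n => ε n * N n) Filter.atTop Filter.atTop) :
    Filter.Tendsto (fun n => ε n • ∑ j ∈ range (N n), a n j) Filter.atTop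
      (nhds (∫ x in Set.Ioi (0 : ℝ), g x)) := by
  have h1 : Filter.Tendsto (fun n => ∫ x in Set.Ioi (0 : ℝ),
      if ⌊x / ε n⌋₊ < N n then a n ⌊x / ε n⌋₊ else 0) Filter.atTop
      (nhds (∫ x in Set.Ioi (0 : ℝ), g x)) := by
    refine MeasureTheory.tendsto_integral_filter_of_dominated_convergence
      (fun x => |C| * Real.exp c * Real.exp (-c * x)) ?_ ?_ ?_ ?_
    · refine Filter.Eventually.of_forall fun n => ?_
      refine MeasureTheory.StronglyMeasurable.aestronglyMeasurable ?_
      have h2 : MeasureTheory.StronglyMeasurable fun j : ℕ => if j < N n then a n j else 0 :=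
        MeasureTheory.StronglyMeasurable.of_discrete
      exact h2.comp_measurable (Nat.measurable_floor.comp (measurable_id.div_const _))
    · filter_upwards [hbound, hε, hε0.eventually (gt_mem_nhds one_pos)] with n hn hpos hlt
      filter_upwards [MeasureTheory.ae_restrict_mem measurableSet_Ioi] with x hx
      have hx : 0 < x := hx
      split_ifs with hj
      · refine (hn _ hj).trans ?_
        rw [mul_assoc, ← Real.exp_add]
        have h2 : x / ε n < ⌊x / ε n⌋₊ + 1 := Nat.lt_floor_add_one _
        rw [div_lt_iff₀ hpos] at h2
        refine mul_le_mul (le_abs_self C) (Real.exp_le_exp.2 ?_) (Real.exp_pos _).le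
          (abs_nonneg C)
        nlinarith
      · rw [norm_zero]
        positivity
    · exact (integrableOn_exp_mul_Ioi (neg_lt_zero.2 hc) 0).const_mul _
    · filter_upwards [MeasureTheory.ae_restrict_mem measurableSet_Ioi] with x hx
      have hx : 0 < x := hx
      refine (hlim x hx).congr' ?_
      filter_upwards [hN.eventually (Filter.eventually_gt_atTop x), hε] with n hn hpos
      rw [if_pos]
      rw [Nat.floor_lt (by positivity), div_lt_iff₀ hpos, mul_comm]
      exact hn
  refine h1.congr' ?_
  filter_upwards [hε] with n hn
  rw [smul_sum_range_eq_integral hn]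

lemma tendsto_mul_floor_div {ε : ℕ → ℝ} (hε : ∀ᶠ n in Filter.atTop, 0 < ε n)
    (hε0 : Filter.Tendsto ε Filter.atTop (nhds 0)) {x : ℝ} (hx : 0 < x) :
    Filter.Tendsto (fun n => ε n * ⌊x / ε n⌋₊) Filter.atTop (nhds x) := by
  have h1 : Filter.Tendsto (fun n => x - ε n) Filter.atTop (nhds x) := by
    simpa using hε0.const_sub x
  refine tendsto_of_tendsto_of_tendsto_of_le_of_le' h1 tendsto_const_nhds ?_ ?_
  · filter_upwards [hε] with n hn
    have h2 : x / ε n < ⌊x / ε n⌋₊ + 1 := Nat.lt_floor_add_one _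
    rw [div_lt_iff₀ hn] at h2
    linarith
  · filter_upwards [hε] with n hn
    have h2 : (⌊x / ε n⌋₊ : ℝ) ≤ x / ε n := Nat.floor_le (by positivity)
    rw [le_div_iff₀ hn] at h2
    linarith

/-- Riemann sums on the half-line. -/
lemma tendsto_saddle_mul_sum {f : ℝ → ℝ} (hf : Continuous f) {C c : ℝ} (hc : 0 < c)
    (hbound : ∀ x, 0 ≤ x → |f x| ≤ C * Real.exp (-c * x)) :
    Filter.Tendsto (fun n => saddle n * ∑ k ∈ Icc 1 n, f (saddle n * k)) Filter.atTop
      (nhds (∫ x in Set.Ioi (0 : ℝ), f x)) := by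
  have hC : 0 ≤ C := by
    have := (abs_nonneg _).trans (hbound 0 le_rfl)
    simpa using this
  have h1 := tendsto_smul_sum_range eventually_saddle_pos tendsto_saddle (fun n => n)
    (fun n j => f (saddle n * (j + 1))) f (C := C) hc ?_ ?_ ?_
  · refine h1.congr fun n => ?_
    rw [smul_eq_mul, Finset.sum_range (fun j => f (saddle n * (j + 1))), ← Finset.sum_range
      (fun j : ℕ => f (saddle n * (j + 1))), Finset.range_eq_Ico,
      ← Finset.Ico_add_one_right_eq_Icc, ← Finset.sum_Ico_add' (fun k : ℕ => f (saddle n * k)) 0 n 1]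
    simp
  · filter_upwards [eventually_saddle_pos] with n hn j _
    refine (hbound _ (by positivity)).trans ?_
    refine mul_le_mul_of_nonneg_left (Real.exp_le_exp.2 ?_) hC
    nlinarith
  · intro x hx
    refine (hf.tendsto x).comp ?_
    have h2 := (tendsto_mul_floor_div eventually_saddle_pos tendsto_saddle hx).add tendsto_saddle
    rw [add_zero] at h2
    refine h2.congr fun n => ?_
    ring
  · exact tendsto_natCast_mul_saddle.congr fun n => mul_comm _ _

/-- The error of the trapezoidal rule on one interval. -/
lemma abs_trapezoid_sub_integral_le {f f' f'' : ℝ → ℝ} (hf : ∀ x, HasDerivAt f (f' x) x)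
    (hf' : ∀ x, HasDerivAt f' (f'' x) x) {a b K : ℝ} (hab : a ≤ b)
    (hK : ∀ x ∈ Set.Icc a b, |f'' x| ≤ K) :
    |(b - a) / 2 * (f a + f b) - ∫ x in a..b, f x| ≤ K * (b - a) ^ 3 := by
  have hfc : Continuous f := continuous_iff_continuousAt.2 fun x => (hf x).continuousAt
  have hfc' : Continuous f' := continuous_iff_continuousAt.2 fun x => (hf' x).continuousAt
  set m : ℝ := (a + b) / 2 with hm
  have hK0 : 0 ≤ K := (abs_nonneg _).trans (hK a ⟨le_rfl, hab⟩)
  have h1 : ∫ x in a..b, (f x + (x - m) * f' x) = (b - m) * f b - (a - m) * f a := by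
    refine intervalIntegral.integral_eq_sub_of_hasDerivAt (f := fun x => (x - m) * f x)
      (fun x _ => ?_) (by apply Continuous.intervalIntegrable; fun_prop)
    exact (((hasDerivAt_id x).sub_const m).mul (hf x)).congr_deriv (by simp)
  have h2 : ∫ x in a..b, (x - m) * f' m = 0 := by
    rw [intervalIntegral.integral_mul_const, intervalIntegral.integral_sub (by simp) (by simp)]
    simp only [integral_id, intervalIntegral.integral_const, smul_eq_mul]
    rw [hm]
    ring
  have h3 : (b - a) / 2 * (f a + f b) - ∫ x in a..b, f x
      = ∫ x in a..b, (x - m) * (f' x - f' m) := by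
    rw [intervalIntegral.integral_add (by apply Continuous.intervalIntegrable; fun_prop)
      (by apply Continuous.intervalIntegrable; fun_prop)] at h1
    simp_rw [mul_sub (_ - m)]
    rw [intervalIntegral.integral_sub (by apply Continuous.intervalIntegrable; fun_prop)
      (by apply Continuous.intervalIntegrable; fun_prop), h2, ← sub_eq_of_eq_add' h1.symm, hm]
    ring
  rw [h3, ← Real.norm_eq_abs]
  have h4 : ∀ x ∈ Set.uIoc a b, ‖(x - m) * (f' x - f' m)‖ ≤ K * (b - a) ^ 2 := by
    intro x hx
    rw [Set.uIoc_of_le hab] at hx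
    have hx' : x ∈ Set.Icc a b := ⟨hx.1.le, hx.2⟩
    have hm' : m ∈ Set.Icc a b := ⟨by linarith, by linarith⟩
    have h5 : ‖f' x - f' m‖ ≤ K * ‖x - m‖ :=
      (convex_Icc a b).norm_image_sub_le_of_norm_hasDerivWithin_le
        (fun y _ => (hf' y).hasDerivWithinAt) hK hm' hx'
    have h6 : ‖x - m‖ ≤ b - a := by
      rw [Real.norm_eq_abs, abs_le]
      constructor <;> linarith [hx'.1, hx'.2]
    rw [norm_mul]
    calc ‖x - m‖ * ‖f' x - f' m‖ ≤ (b - a) * (K * (b - a)) := by gcongr; exact h5.trans (by gcongr)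
      _ = K * (b - a) ^ 2 := by ring
  refine (intervalIntegral.norm_integral_le_of_norm_le_const h4).trans_eq ?_
  rw [abs_of_nonneg (sub_nonneg.2 hab)]
  ring

lemma sum_range_exp_le {c ε : ℝ} (hc : 0 < c) (hε : 0 < ε) (N : ℕ) :
    ∑ k ∈ range N, Real.exp (-c * (ε * k)) ≤ 1 + 1 / (c * ε) := by
  have h0 : 0 < c * ε := mul_pos hc hε
  have h1 : Real.exp (-(c * ε)) * (1 + c * ε) ≤ 1 := by
    have := Real.add_one_le_exp (c * ε)
    rw [Real.exp_neg, inv_mul_le_iff₀ (Real.exp_pos _)]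
    linarith
  have h2 : ∀ k : ℕ, Real.exp (-c * (ε * k)) = Real.exp (-(c * ε)) ^ k := by
    intro k
    rw [← Real.exp_nat_mul]
    ring_nf
  simp_rw [h2]
  have h3 := geom_sum_mul (Real.exp (-(c * ε))) N
  set r := Real.exp (-(c * ε))
  have hr : 0 < r := Real.exp_pos _
  have h4 : r < 1 := by nlinarith
  have h5 : 0 ≤ r ^ N := by positivity
  have h6 : (∑ i ∈ range N, r ^ i) * (1 - r) ≤ 1 := by linarith
  have h7 : 1 ≤ (1 - r) * (1 + 1 / (c * ε)) := by
    have : (1 - r) * (1 + 1 / (c * ε)) - 1 = (1 - r * (1 + c * ε)) / (c * ε) := by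
      field_simp
      ring
    have : 0 ≤ (1 - r * (1 + c * ε)) / (c * ε) := div_nonneg (by linarith) h0.le
    linarith
  have h8 : 0 < 1 - r := by linarith
  exact le_of_mul_le_mul_right (h6.trans (by linarith)) h8

/-- The trapezoidal rule on the half-line. -/
lemma tendsto_sum_sub_integral_div {f f' f'' : ℝ → ℝ} (hf : ∀ x, HasDerivAt f (f' x) x)
    (hf' : ∀ x, HasDerivAt f' (f'' x) x) {C c : ℝ} (hc : 0 < c)
    (hb : ∀ x, 0 ≤ x → |f x| ≤ C * Real.exp (-c * x))
    (hb'' : ∀ x, 0 ≤ x → |f'' x| ≤ C * Real.exp (-c * x)) :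
    Filter.Tendsto (fun n => ∑ k ∈ Icc 1 n, f (saddle n * k)
      - (∫ x in Set.Ioi (0 : ℝ), f x) / saddle n) Filter.atTop (nhds (-(f 0 / 2))) := by
  have hfc : Continuous f := continuous_iff_continuousAt.2 fun x => (hf x).continuousAt
  have hC : 0 ≤ C := by
    have := (abs_nonneg _).trans (hb 0 le_rfl)
    simpa using this
  have hInt : MeasureTheory.IntegrableOn f (Set.Ioi 0) := by
    refine MeasureTheory.Integrable.mono' ((integrableOn_exp_mul_Ioi (neg_lt_zero.2 hc) 0).const_mul C)
      hfc.aestronglyMeasurable ?_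
    filter_upwards [MeasureTheory.ae_restrict_mem measurableSet_Ioi] with x hx
    exact hb x (le_of_lt hx)
  have htail : ∀ a, 0 ≤ a → |∫ x in Set.Ioi a, f x| ≤ C / c * Real.exp (-c * a) := by
    intro a ha
    have h1 : ‖∫ x in Set.Ioi a, f x‖ ≤ ∫ x in Set.Ioi a, C * Real.exp (-c * x) := by
      refine MeasureTheory.norm_integral_le_of_norm_le
        ((integrableOn_exp_mul_Ioi (neg_lt_zero.2 hc) a).const_mul C) ?_
      filter_upwards [MeasureTheory.ae_restrict_mem measurableSet_Ioi] with x hx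
      exact hb x (ha.trans (le_of_lt hx))
    refine h1.trans_eq ?_
    rw [MeasureTheory.integral_const_mul, integral_exp_mul_Ioi (neg_lt_zero.2 hc)]
    field_simp
  have hmain : ∀ n, 0 < saddle n → |∑ k ∈ Icc 1 n, f (saddle n * k)
      - (∫ x in Set.Ioi (0 : ℝ), f x) / saddle n - (-(f 0 / 2))|
      ≤ C * (saddle n ^ 2 + saddle n / c) + C * Real.exp (-c * (n * saddle n))
        + C / c * ((saddle n)⁻¹ * Real.exp (-c * (n * saddle n))) := by
    intro n hn
    set ε := saddle n
    have h1 : ∫ x in (0 : ℝ)..(ε * n), f x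
        = ∑ k ∈ range n, ∫ x in (ε * k)..(ε * (k + 1 : ℕ)), f x := by
      rw [intervalIntegral.sum_integral_adjacent_intervals
        (f := f) (a := fun k : ℕ => ε * k) fun k _ => hfc.intervalIntegrable _ _]
      simp
    have h2 : ∫ x in Set.Ioi (0 : ℝ), f x
        = (∫ x in (0 : ℝ)..(ε * n), f x) + ∫ x in Set.Ioi (ε * n), f x :=
      (intervalIntegral.integral_interval_add_Ioi hInt
        (hInt.mono_set (Set.Ioi_subset_Ioi (by positivity)))).symm
    have h3 : ∀ k ∈ range n, |ε / 2 * (f (ε * k) + f (ε * (k + 1 : ℕ)))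
        - ∫ x in (ε * k)..(ε * (k + 1 : ℕ)), f x| ≤ C * Real.exp (-c * (ε * k)) * ε ^ 3 := by
      intro k _
      have h4 : (ε * (k + 1 : ℕ)) - ε * k = ε := by push_cast; ring
      have h5 := abs_trapezoid_sub_integral_le hf hf' (a := ε * k) (b := ε * (k + 1 : ℕ))
        (K := C * Real.exp (-c * (ε * k))) (by linarith) ?_
      · rwa [h4] at h5
      · intro x hx
        have h0 : 0 ≤ ε * k := by positivity
        refine (hb'' x (h0.trans hx.1)).trans ?_
        refine mul_le_mul_of_nonneg_left (Real.exp_le_exp.2 ?_) hC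
        nlinarith [hx.1]
    have h4 : |∑ k ∈ range n, ε / 2 * (f (ε * k) + f (ε * (k + 1 : ℕ)))
        - ∫ x in (0 : ℝ)..(ε * n), f x| ≤ C * ε ^ 3 * (1 + 1 / (c * ε)) := by
      rw [h1, ← Finset.sum_sub_distrib]
      refine (Finset.abs_sum_le_sum_abs _ _).trans ((Finset.sum_le_sum h3).trans ?_)
      rw [← Finset.sum_mul, ← Finset.mul_sum]
      have := sum_range_exp_le hc hn n
      calc _ ≤ C * (1 + 1 / (c * ε)) * ε ^ 3 := by gcongr
        _ = _ := by ring
    have h5 : ∑ k ∈ range n, ε / 2 * (f (ε * k) + f (ε * (k + 1 : ℕ)))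
        = ε * (∑ k ∈ Icc 1 n, f (ε * k) + f 0 / 2 - f (ε * n) / 2) := by
      clear_value ε
      clear h1 h2 h3 h4
      induction n with
      | zero => simp
      | succ n ih =>
        rw [Finset.sum_range_succ, ih, Finset.sum_Icc_succ_top (by omega)]
        ring
    rw [h5] at h4
    have h6 := htail (ε * n) (by positivity)
    have h7 := hb (ε * n) (by positivity)
    rw [mul_comm ε (n : ℝ)] at h6 h7 h4 h2
    set S := ∑ k ∈ Icc 1 n, f (ε * k)
    set A := ∫ x in (0 : ℝ)..(n * ε), f x
    set T := ∫ x in Set.Ioi (n * ε), f x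
    have h8 : S - (∫ x in Set.Ioi (0 : ℝ), f x) / ε - (-(f 0 / 2))
        = (ε * (S + f 0 / 2 - f (n * ε) / 2) - A) / ε + f (n * ε) / 2 - T / ε := by
      rw [h2]
      field_simp
      ring
    rw [h8]
    have h9 : |(ε * (S + f 0 / 2 - f (n * ε) / 2) - A) / ε| ≤ C * (ε ^ 2 + ε / c) := by
      rw [abs_div, abs_of_pos hn, div_le_iff₀ hn]
      refine h4.trans_eq ?_
      field_simp
    have h10 : |T / ε| ≤ C / c * (ε⁻¹ * Real.exp (-c * (n * ε))) := by
      rw [abs_div, abs_of_pos hn, div_le_iff₀ hn]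
      refine h6.trans_eq ?_
      field_simp
    have h11 : |f (n * ε) / 2| ≤ C * Real.exp (-c * (n * ε)) := by
      rw [abs_div, abs_two]
      linarith [abs_nonneg (f (n * ε))]
    refine (abs_sub _ _).trans (add_le_add ((abs_add_le _ _).trans (add_le_add h9 h11)) h10)
  rw [tendsto_iff_norm_sub_tendsto_zero]
  have hexp : Filter.Tendsto (fun n : ℕ => Real.exp (-c * (n * saddle n))) Filter.atTop
      (nhds 0) := by
    refine Real.tendsto_exp_atBot.comp ?_
    exact tendsto_natCast_mul_saddle.const_mul_atTop_of_neg (neg_lt_zero.2 hc)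
  have hlim : Filter.Tendsto (fun n : ℕ => C * (saddle n ^ 2 + saddle n / c)
      + C * Real.exp (-c * (n * saddle n))
        + C / c * ((saddle n)⁻¹ * Real.exp (-c * (n * saddle n)))) Filter.atTop (nhds 0) := by
    have := ((((tendsto_saddle.pow 2).add (tendsto_saddle.div_const c)).const_mul C).add
      (hexp.const_mul C)).add ((tendsto_saddle_inv_mul_exp hc).const_mul (C / c))
    simpa using this
  refine squeeze_zero' (Filter.Eventually.of_forall fun _ => norm_nonneg _) ?_ hlim
  filter_upwards [eventually_saddle_pos] with n hn
  exact hmain n hn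

lemma abs_le_mul_exp_neg_half {f : ℝ → ℝ} {A B : ℝ} (hB : 0 ≤ B)
    (hf : ∀ x, 0 ≤ x → |f x| ≤ (A + B * x) * Real.exp (-x)) (hA : 0 ≤ A) (x : ℝ) (hx : 0 ≤ x) :
    |f x| ≤ (A + 2 * B) * Real.exp (-(1 / 2) * x) := by
  refine (hf x hx).trans ?_
  have h1 : Real.exp (-x) = Real.exp (-(1 / 2) * x) * Real.exp (-(1 / 2) * x) := by
    rw [← Real.exp_add]
    ring_nf
  have h2 : Real.exp (-(1 / 2) * x) ≤ 1 := Real.exp_le_one_iff.2 (by linarith)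
  have h3 : x / 2 * Real.exp (-(1 / 2) * x) ≤ 1 := by
    have := Real.add_one_le_exp (x / 2)
    have h4 : Real.exp (-(1 / 2) * x) * Real.exp (x / 2) = 1 := by
      rw [← Real.exp_add]
      simp
      ring
    nlinarith [Real.exp_pos (-(1 / 2) * x)]
  rw [h1, ← mul_assoc]
  refine mul_le_mul_of_nonneg_right ?_ (Real.exp_pos _).le
  nlinarith

lemma integral_mul_exp_neg_mul {b : ℝ} (hb : 0 < b) :
    ∫ x in Set.Ioi (0 : ℝ), x * Real.exp (-(b * x)) = 1 / b ^ 2 := by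
  have h := Real.integral_rpow_mul_exp_neg_mul_Ioi (a := 2) (r := b) (by norm_num) hb
  norm_num at h
  rw [h]
  simp

lemma integrableOn_mul_exp_neg_mul {b : ℝ} (hb : 0 < b) :
    MeasureTheory.IntegrableOn (fun x => x * Real.exp (-(b * x))) (Set.Ioi 0) := by
  refine MeasureTheory.Integrable.of_integral_ne_zero ?_
  rw [integral_mul_exp_neg_mul hb]
  positivity

lemma hasSum_alternating_inv_sq :
    HasSum (fun m : ℕ => (-1 : ℝ) ^ m * (1 / ((m : ℝ) + 1) ^ 2)) (Real.pi ^ 2 / 12) := by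
  have h1 : HasSum (fun m : ℕ => 1 / ((m : ℝ) + 1) ^ 2) (Real.pi ^ 2 / 6) := by
    have := (hasSum_nat_add_iff' (f := fun n : ℕ => (1 : ℝ) / (n : ℝ) ^ 2) 1).2 hasSum_zeta_two
    simpa using this
  have hodd : HasSum (fun k : ℕ => 1 / (((2 * k + 1 : ℕ) : ℝ) + 1) ^ 2) (Real.pi ^ 2 / 24) := by
    have := h1.mul_left (1 / 4)
    rw [show Real.pi ^ 2 / 24 = 1 / 4 * (Real.pi ^ 2 / 6) by ring]
    refine this.congr_fun fun k => ?_
    push_cast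
    have : (k : ℝ) + 1 ≠ 0 := by positivity
    field_simp
    ring
  have heven : Summable (fun k : ℕ => 1 / (((2 * k : ℕ) : ℝ) + 1) ^ 2) :=
    h1.summable.comp_injective (i := fun k : ℕ => 2 * k) (mul_right_injective₀ two_ne_zero)
  have h2 := heven.hasSum.even_add_odd (f := fun m : ℕ => 1 / ((m : ℝ) + 1) ^ 2) hodd
  have h3 := h2.unique h1
  have h4 := HasSum.even_add_odd (f := fun m : ℕ => (-1 : ℝ) ^ m * (1 / ((m : ℝ) + 1) ^ 2))
    (m := ∑' k : ℕ, 1 / (((2 * k : ℕ) : ℝ) + 1) ^ 2) (m' := -(Real.pi ^ 2 / 24)) ?_ ?_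
  · rwa [show ∑' k : ℕ, 1 / (((2 * k : ℕ) : ℝ) + 1) ^ 2 + -(Real.pi ^ 2 / 24) = Real.pi ^ 2 / 12 by
      linarith] at h4
  · simpa using heven.hasSum
  · refine hodd.neg.congr_fun fun k => ?_
    rw [pow_succ, pow_mul]
    simp

lemma integral_mul_fermi : ∫ x in Set.Ioi (0 : ℝ), x * fermi x = Real.pi ^ 2 / 12 := by
  have h1 : HasSum (fun m : ℕ => ∫ x in Set.Ioi (0 : ℝ), (-1) ^ m * (x * Real.exp (-((m + 1) * x))))
      (∫ x in Set.Ioi (0 : ℝ), ∑' m : ℕ, (-1) ^ m * (x * Real.exp (-((m + 1) * x)))) := by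
    refine MeasureTheory.hasSum_integral_of_summable_integral_norm
      (fun m => (integrableOn_mul_exp_neg_mul (by positivity)).const_mul _) ?_
    have h2 : ∀ m : ℕ, ∫ x in Set.Ioi (0 : ℝ), ‖(-1) ^ m * (x * Real.exp (-((m + 1) * x)))‖
        = 1 / ((m : ℝ) + 1) ^ 2 := by
      intro m
      rw [← integral_mul_exp_neg_mul (by positivity)]
      refine MeasureTheory.setIntegral_congr_fun measurableSet_Ioi fun x hx => ?_
      have : 0 < x := hx
      simp [abs_of_pos this]
    simp_rw [h2]
    have := hasSum_alternating_inv_sq.summable.norm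
    refine this.congr fun m => ?_
    simp
  simp_rw [MeasureTheory.integral_const_mul] at h1
  have h2 := h1.unique (hasSum_alternating_inv_sq.congr_fun fun m => by
    rw [integral_mul_exp_neg_mul (by positivity)])
  rw [← h2]
  refine MeasureTheory.setIntegral_congr_fun measurableSet_Ioi fun x hx => ?_
  have hx : 0 < x := hx
  have h3 : Real.exp (-x) < 1 := by simpa using hx
  have h4 := (hasSum_geometric_of_abs_lt_one (r := -Real.exp (-x)) (by
    rw [abs_neg, abs_of_pos (Real.exp_pos _)]; exact h3)).mul_left (x * Real.exp (-x))
  refine Eq.trans ?_ (h4.congr_fun (g := fun m : ℕ => (-1) ^ m * (x * Real.exp (-((m + 1) * x))))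
    fun m => ?_).tsum_eq.symm
  · rw [fermi, sub_neg_eq_add]
    ring
  · rw [neg_pow (Real.exp (-x)), ← Real.exp_nat_mul, show -(((m : ℝ) + 1) * x) = -x + m * -x by ring, Real.exp_add]
    ring

lemma integrableOn_mul_fermi :
    MeasureTheory.IntegrableOn (fun x => x * fermi x) (Set.Ioi 0) := by
  refine MeasureTheory.Integrable.of_integral_ne_zero ?_
  rw [integral_mul_fermi]
  positivity

lemma hasDerivAt_log_one_add_exp_neg (x : ℝ) :
    HasDerivAt (fun x : ℝ => Real.log (1 + Real.exp (-x))) (-fermi x) x := by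
  have h1 : HasDerivAt (fun x : ℝ => Real.exp (-x)) (-Real.exp (-x)) x := by
    simpa using (hasDerivAt_neg x).exp
  refine ((h1.const_add 1).log (by positivity)).congr_deriv ?_
  rw [fermi]
  ring

lemma log_one_add_exp_neg_nonneg (x : ℝ) : 0 ≤ Real.log (1 + Real.exp (-x)) :=
  Real.log_nonneg (by linarith [Real.exp_pos (-x)])

lemma log_one_add_exp_neg_le (x : ℝ) : Real.log (1 + Real.exp (-x)) ≤ Real.exp (-x) := by
  have := Real.log_le_sub_one_of_pos (x := 1 + Real.exp (-x)) (by positivity)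
  linarith

lemma tendsto_pow_mul_atTop {f : ℝ → ℝ} (m : ℕ) (h0 : ∀ x, 0 ≤ f x)
    (h1 : ∀ x, f x ≤ Real.exp (-x)) :
    Filter.Tendsto (fun x => x ^ m * f x) Filter.atTop (nhds 0) := by
  refine squeeze_zero' ?_ ?_ (Real.tendsto_pow_mul_exp_neg_atTop_nhds_zero m)
  · filter_upwards [Filter.eventually_ge_atTop 0] with x hx
    exact mul_nonneg (by positivity) (h0 x)
  · filter_upwards [Filter.eventually_ge_atTop 0] with x hx
    exact mul_le_mul_of_nonneg_left (h1 x) (by positivity)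

lemma integral_log_one_add_exp_neg :
    ∫ x in Set.Ioi (0 : ℝ), Real.log (1 + Real.exp (-x)) = Real.pi ^ 2 / 12 := by
  have hc : Continuous fun x : ℝ => Real.log (1 + Real.exp (-x)) :=
    continuous_iff_continuousAt.2 fun x => (hasDerivAt_log_one_add_exp_neg x).continuousAt
  have hInt : MeasureTheory.IntegrableOn (fun x : ℝ => Real.log (1 + Real.exp (-x)))
      (Set.Ioi 0) := by
    refine MeasureTheory.Integrable.mono' (integrableOn_exp_neg_Ioi 0) hc.aestronglyMeasurable ?_
    refine Filter.Eventually.of_forall fun x => ?_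
    rw [Real.norm_eq_abs, abs_of_nonneg (log_one_add_exp_neg_nonneg x)]
    exact log_one_add_exp_neg_le x
  have h1 := MeasureTheory.integral_Ioi_of_hasDerivAt_of_tendsto'
    (f := fun x : ℝ => x ^ 1 * Real.log (1 + Real.exp (-x))) (a := 0)
    (fun x _ => ((hasDerivAt_pow 1 x).mul (hasDerivAt_log_one_add_exp_neg x)).congr_deriv
      (show _ = Real.log (1 + Real.exp (-x)) - x * fermi x by simp; ring))
    (hInt.sub integrableOn_mul_fermi)
    (tendsto_pow_mul_atTop 1 log_one_add_exp_neg_nonneg log_one_add_exp_neg_le)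
  rw [MeasureTheory.integral_sub' hInt integrableOn_mul_fermi, integral_mul_fermi] at h1
  norm_num at h1
  linarith

lemma fermi_mul_one_sub_nonneg (x : ℝ) : 0 ≤ fermi x * (1 - fermi x) :=
  mul_nonneg (fermi_pos x).le (by linarith [fermi_lt_one x])

lemma fermi_mul_one_sub_le (x : ℝ) : fermi x * (1 - fermi x) ≤ Real.exp (-x) := by
  refine le_trans ?_ (fermi_le_exp x)
  nlinarith [fermi_pos x]

lemma integral_sq_mul_fermi_mul_one_sub :
    ∫ x in Set.Ioi (0 : ℝ), x ^ 2 * (fermi x * (1 - fermi x)) = Real.pi ^ 2 / 6 := by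
  have hInt2 : MeasureTheory.IntegrableOn (fun x => 2 * (x * fermi x)) (Set.Ioi 0) :=
    integrableOn_mul_fermi.const_mul 2
  have hInt : MeasureTheory.IntegrableOn (fun x => x ^ 2 * (fermi x * (1 - fermi x)))
      (Set.Ioi 0) := by
    have h0 : MeasureTheory.IntegrableOn (fun x : ℝ => x ^ 2 * Real.exp (-x)) (Set.Ioi 0) := by
      refine MeasureTheory.Integrable.of_integral_ne_zero ?_
      have h := Real.integral_rpow_mul_exp_neg_mul_Ioi (a := 3) (r := 1) (by norm_num) one_pos
      norm_num at h
      rw [h]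
      norm_num
    refine MeasureTheory.Integrable.mono' h0 (by fun_prop) ?_
    refine Filter.Eventually.of_forall fun x => ?_
    rw [Real.norm_eq_abs, abs_of_nonneg (mul_nonneg (sq_nonneg x) (fermi_mul_one_sub_nonneg x))]
    exact mul_le_mul_of_nonneg_left (fermi_mul_one_sub_le x) (sq_nonneg x)
  have h1 := MeasureTheory.integral_Ioi_of_hasDerivAt_of_tendsto'
    (f := fun x : ℝ => x ^ 2 * fermi x) (a := 0)
    (fun x _ => ((hasDerivAt_pow 2 x).mul (hasDerivAt_fermi x)).congr_deriv
      (show _ = 2 * (x * fermi x) - x ^ 2 * (fermi x * (1 - fermi x)) by simp; ring))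
    (hInt2.sub hInt) (tendsto_pow_mul_atTop 2 (fun x => (fermi_pos x).le) fermi_le_exp)
  rw [MeasureTheory.integral_sub' hInt2 hInt, MeasureTheory.integral_const_mul,
    integral_mul_fermi] at h1
  norm_num at h1
  linarith

/-- The logarithm of the generating function of partitions into distinct parts at the saddle
point. -/
lemma tendsto_sum_log_one_add_exp :
    Filter.Tendsto (fun n => ∑ k ∈ Icc 1 n, Real.log (1 + Real.exp (-saddle n * k))
      - Real.pi ^ 2 / 12 / saddle n) Filter.atTop (nhds (-(Real.log 2 / 2))) := by
  have h := tendsto_sum_sub_integral_div hasDerivAt_log_one_add_exp_neg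
    (fun x => (hasDerivAt_fermi x).neg) (C := 1) (c := 1) one_pos ?_ ?_
  · rw [integral_log_one_add_exp_neg] at h
    norm_num at h
    simpa using h
  · intro x _
    rw [abs_of_nonneg (log_one_add_exp_neg_nonneg x)]
    simpa using log_one_add_exp_neg_le x
  · intro x _
    rw [neg_neg, abs_of_nonneg (fermi_mul_one_sub_nonneg x)]
    simpa using fermi_mul_one_sub_le x

/-- The mean size of the random partition at the saddle point. -/
lemma tendsto_sum_mul_fermi_sub :
    Filter.Tendsto (fun n => saddle n * (∑ k ∈ Icc 1 n, k * fermi (saddle n * k) - n))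
      Filter.atTop (nhds 0) := by
  have hd : ∀ x, HasDerivAt (fun x => x * fermi x) (fermi x - x * (fermi x * (1 - fermi x))) x :=
    fun x => ((hasDerivAt_id x).mul (hasDerivAt_fermi x)).congr_deriv (by simp; ring)
  have hd' : ∀ x, HasDerivAt (fun x => fermi x - x * (fermi x * (1 - fermi x)))
      (-(2 * (fermi x * (1 - fermi x))) + x * (fermi x * (1 - fermi x)) * (1 - 2 * fermi x)) x :=
    fun x => ((hasDerivAt_fermi x).sub ((hasDerivAt_id x).mul
      ((hasDerivAt_fermi x).mul ((hasDerivAt_fermi x).const_sub 1)))).congr_deriv (by simp; ring)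
  have h := tendsto_sum_sub_integral_div hd hd' (C := 4) (c := 1 / 2) (by norm_num) ?_ ?_
  · rw [integral_mul_fermi] at h
    norm_num at h
    refine h.congr' ?_
    filter_upwards [Filter.eventually_ge_atTop 1] with n hn
    have h1 := natCast_mul_saddle hn
    rw [div_eq_mul_inv, ← h1, mul_sub, Finset.mul_sum]
    congr 1
    · exact Finset.sum_congr rfl fun k _ => by ring
    · ring
  · intro x hx
    have := abs_le_mul_exp_neg_half (f := fun x => x * fermi x) (A := 2) (B := 1) one_pos.le ?_
      (by norm_num) x hx
    · norm_num at this ⊢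
      exact this
    · intro x hx
      rw [abs_of_nonneg (mul_nonneg hx (fermi_pos x).le)]
      exact mul_le_mul (by linarith) (fermi_le_exp x) (fermi_pos x).le (by linarith)
  · intro x hx
    have := abs_le_mul_exp_neg_half (f := fun x => -(2 * (fermi x * (1 - fermi x)))
      + x * (fermi x * (1 - fermi x)) * (1 - 2 * fermi x)) (A := 2) (B := 1) one_pos.le ?_
      (by norm_num) x hx
    · norm_num at this ⊢
      exact this
    · intro x hx
      have h1 := fermi_pos x
      have h2 := fermi_lt_one x
      have h3 := fermi_mul_one_sub_nonneg x
      have h4 := fermi_mul_one_sub_le x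
      have h5 : |1 - 2 * fermi x| ≤ 1 := by rw [abs_le]; constructor <;> linarith
      refine (abs_add_le _ _).trans ?_
      rw [abs_neg, abs_of_nonneg (by positivity), abs_mul, abs_of_nonneg (mul_nonneg hx h3)]
      have h6 : x * (fermi x * (1 - fermi x)) * |1 - 2 * fermi x|
          ≤ x * (fermi x * (1 - fermi x)) * 1 :=
        mul_le_mul_of_nonneg_left h5 (mul_nonneg hx h3)
      nlinarith

/-- The variance of the size of the random partition at the saddle point. -/
lemma tendsto_sum_sq_mul_fermi :
    Filter.Tendsto (fun n => saddle n ^ 3 * ∑ k ∈ Icc 1 n,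
      (k : ℝ) ^ 2 * (fermi (saddle n * k) * (1 - fermi (saddle n * k))))
      Filter.atTop (nhds (Real.pi ^ 2 / 6)) := by
  have h := tendsto_saddle_mul_sum (f := fun x => x ^ 2 * (fermi x * (1 - fermi x)))
    (by fun_prop) (C := 8) (c := 1 / 2) (by norm_num) ?_
  · rw [integral_sq_mul_fermi_mul_one_sub] at h
    refine h.congr fun n => ?_
    rw [Finset.mul_sum, Finset.mul_sum]
    exact Finset.sum_congr rfl fun k _ => by ring
  · intro x hx
    rw [abs_of_nonneg (mul_nonneg (sq_nonneg x) (fermi_mul_one_sub_nonneg x))]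
    have h1 := Real.pow_div_factorial_le_exp (x / 2) (by positivity) 2
    have h2 : Real.exp (-x) = Real.exp (-(1 / 2) * x) * Real.exp (-(1 / 2) * x) := by
      rw [← Real.exp_add]
      ring_nf
    have h3 : Real.exp (-(1 / 2) * x) * Real.exp (x / 2) = 1 := by
      rw [← Real.exp_add]
      simp
      ring
    have h4 := Real.exp_pos (-(1 / 2) * x)
    have h5 : x ^ 2 * Real.exp (-(1 / 2) * x) ≤ 8 := by
      have : (x / 2) ^ 2 / (Nat.factorial 2 : ℝ) = x ^ 2 / 8 := by
        norm_num [Nat.factorial]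
        ring
      rw [this] at h1
      nlinarith
    calc x ^ 2 * (fermi x * (1 - fermi x)) ≤ x ^ 2 * Real.exp (-x) :=
          mul_le_mul_of_nonneg_left (fermi_mul_one_sub_le x) (sq_nonneg x)
      _ = x ^ 2 * Real.exp (-(1 / 2) * x) * Real.exp (-(1 / 2) * x) := by rw [h2]; ring
      _ ≤ _ := mul_le_mul_of_nonneg_right h5 h4.le

lemma one_sub_exp_le_norm_one_add_circlePt_pow {ε : ℝ} (θ : ℝ) (k : ℕ) :
    1 - Real.exp (-ε * k) ≤ ‖1 + circlePt ε θ ^ k‖ := by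
  have h1 := norm_sub_norm_le (1 : ℂ) (-(circlePt ε θ ^ k))
  rw [norm_neg, norm_circlePt_pow, sub_neg_eq_add, norm_one] at h1
  exact h1

lemma half_le_norm_one_add_circlePt_pow {ε : ℝ} (hε : 0 < ε) (hε1 : ε ≤ 1) (θ : ℝ) {k : ℕ}
    (hk : 1 ≤ k) : ε / 2 ≤ ‖1 + circlePt ε θ ^ k‖ := by
  refine le_trans ?_ (one_sub_exp_le_norm_one_add_circlePt_pow θ k)
  have hk' : (1 : ℝ) ≤ k := by exact_mod_cast hk
  have h1 : Real.exp (-ε * k) ≤ Real.exp (-ε) := Real.exp_le_exp.2 (by nlinarith)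
  have h2 := Real.add_one_le_exp ε
  have h3 : Real.exp (-ε) * Real.exp ε = 1 := by rw [← Real.exp_add]; simp
  nlinarith [Real.exp_pos (-ε)]

lemma quarter_le_norm_one_add_circlePt_pow {ε θ : ℝ} (hθ : |θ| ≤ 4 * ε) (k : ℕ) :
    1 / 4 ≤ ‖1 + circlePt ε θ ^ k‖ := by
  rcases le_or_gt (ε * k) (1 / 3) with hk | hk
  · have h1 : |(k : ℝ) * θ| ≤ Real.pi / 2 := by
      rw [abs_mul, Nat.abs_cast]
      have := mul_le_mul_of_nonneg_left hθ (Nat.cast_nonneg (α := ℝ) k)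
      linarith [Real.pi_gt_three]
    have h2 : 0 ≤ Real.cos (k * θ) := Real.cos_nonneg_of_mem_Icc (abs_le.1 h1)
    have h3 : (1 + circlePt ε θ ^ k).re = 1 + Real.exp (-ε * k) * Real.cos (k * θ) := by
      rw [circlePt_pow, Complex.add_re, Complex.exp_re]
      simp [mul_comm]
    refine le_trans ?_ (Complex.re_le_norm _)
    rw [h3]
    linarith [mul_nonneg (Real.exp_pos (-ε * k)).le h2]
  · refine le_trans ?_ (one_sub_exp_le_norm_one_add_circlePt_pow θ k)
    have h2 := Real.add_one_le_exp (ε * k)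
    have h3 : Real.exp (-ε * k) * Real.exp (ε * k) = 1 := by rw [← Real.exp_add]; simp
    nlinarith [Real.exp_pos (-ε * k)]

lemma norm_hookRatio_term_le {h : ℕ} {x : ℕ × Finset ℕ} (hx : x ∈ hookPatterns h) {ε θ r : ℝ}
    (hε : 0 < ε) (hr : 0 < r) (hr1 : r ≤ 1) (hb : ∀ k, 1 ≤ k → r ≤ ‖1 + circlePt ε θ ^ k‖)
    (j : ℕ) :
    ‖circlePt ε θ ^ (∑ t ∈ x.2, t + j * #x.2) / ∏ k ∈ Ioc j (j + x.1), (1 + circlePt ε θ ^ k)‖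
      ≤ (r ^ h)⁻¹ * Real.exp (-1 * (ε * j)) := by
  have hs := one_le_card_of_mem_hookPatterns hx
  have hd : x.1 ≤ h := by
    have := (mem_hookPatterns.1 hx).2.2
    omega
  rw [norm_div, norm_circlePt_pow, norm_prod, div_eq_inv_mul]
  have h1 : r ^ h ≤ ∏ k ∈ Ioc j (j + x.1), ‖1 + circlePt ε θ ^ k‖ := by
    calc r ^ h ≤ r ^ x.1 := pow_le_pow_of_le_one hr.le hr1 hd
      _ = ∏ k ∈ Ioc j (j + x.1), r := by simp
      _ ≤ _ := Finset.prod_le_prod (fun _ _ => hr.le) fun k hk => hb k (by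
        have := (Finset.mem_Ioc.1 hk).1
        omega)
  have h2 : (j : ℝ) ≤ ((∑ t ∈ x.2, t + j * #x.2 : ℕ) : ℝ) := by
    exact_mod_cast (Nat.le_mul_of_pos_right j hs).trans (Nat.le_add_left _ _)
  have h3 := mul_le_mul_of_nonneg_left h2 hε.le
  refine mul_le_mul (inv_anti₀ (by positivity) h1) (Real.exp_le_exp.2 (by linarith))
    (Real.exp_pos _).le (by positivity)

lemma norm_hookRatio_le (h n : ℕ) {ε θ r : ℝ} (hε : 0 < ε) (hε1 : ε ≤ 1) (hr : 0 < r)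
    (hr1 : r ≤ 1) (hb : ∀ k, 1 ≤ k → r ≤ ‖1 + circlePt ε θ ^ k‖) :
    ε * ‖hookRatio h n ε θ‖ ≤ 2 * #(hookPatterns h) * (r ^ h)⁻¹ := by
  have h1 : ‖hookRatio h n ε θ‖
      ≤ ∑ _x ∈ hookPatterns h, (r ^ h)⁻¹ * (1 + 1 / (1 * ε)) := by
    refine norm_sum_le_of_le _ fun x hx => ?_
    refine (norm_sum_le_of_le _ fun j _ => norm_hookRatio_term_le hx hε hr hr1 hb j).trans ?_
    rw [← Finset.mul_sum]
    exact mul_le_mul_of_nonneg_left (sum_range_exp_le one_pos hε _) (by positivity)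
  rw [Finset.sum_const, nsmul_eq_mul] at h1
  have h2 : ε * (1 + 1 / (1 * ε)) ≤ 2 := by
    rw [one_mul, mul_add, mul_one_div_cancel hε.ne']
    linarith
  calc ε * ‖hookRatio h n ε θ‖ ≤ ε * (#(hookPatterns h) * ((r ^ h)⁻¹ * (1 + 1 / (1 * ε)))) := by
        gcongr
    _ = #(hookPatterns h) * (r ^ h)⁻¹ * (ε * (1 + 1 / (1 * ε))) := by ring
    _ ≤ #(hookPatterns h) * (r ^ h)⁻¹ * 2 := by gcongr
    _ = _ := by ring

lemma norm_hookRatio_le_of_abs_le (h n : ℕ) {ε θ : ℝ} (hε : 0 < ε) (hε1 : ε ≤ 1)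
    (hθ : |θ| ≤ 4 * ε) : ε * ‖hookRatio h n ε θ‖ ≤ 2 * #(hookPatterns h) * 4 ^ h := by
  refine (norm_hookRatio_le h n hε hε1 (r := 1 / 4) (by norm_num) (by norm_num)
    fun k _ => quarter_le_norm_one_add_circlePt_pow hθ k).trans_eq ?_
  simp

lemma norm_hookRatio_le_pow (h n : ℕ) {ε : ℝ} (hε : 0 < ε) (hε1 : ε ≤ 1) (θ : ℝ) :
    ε * ‖hookRatio h n ε θ‖ ≤ 2 * #(hookPatterns h) * (2 * ε⁻¹) ^ h := by
  refine (norm_hookRatio_le h n hε hε1 (r := ε / 2) (by positivity) (by linarith)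
    fun k hk => half_le_norm_one_add_circlePt_pow hε hε1 θ hk).trans_eq ?_
  rw [← inv_pow, inv_div, div_eq_mul_inv]

lemma tendsto_circlePt_pow {θ : ℕ → ℝ}
    (hθ : Filter.Tendsto (fun n => θ n / saddle n) Filter.atTop (nhds 0)) {x : ℝ} (hx : 0 < x)
    (s i : ℕ) :
    Filter.Tendsto (fun n => circlePt (saddle n) (θ n) ^ (i + ⌊x / saddle n⌋₊ * s)) Filter.atTop
      (nhds ((Real.exp (-x) ^ s : ℝ) : ℂ)) := by
  have h1 := tendsto_mul_floor_div eventually_saddle_pos tendsto_saddle hx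
  have h2 : Filter.Tendsto (fun n => saddle n * ((i + ⌊x / saddle n⌋₊ * s : ℕ) : ℝ)) Filter.atTop
      (nhds (x * s)) := by
    have := (tendsto_saddle.mul_const (i : ℝ)).add (h1.mul_const (s : ℝ))
    simp only [zero_mul, zero_add] at this
    refine this.congr fun n => ?_
    push_cast
    ring
  have h3 : Filter.Tendsto (fun n => ((saddle n * ((i + ⌊x / saddle n⌋₊ * s : ℕ) : ℝ) : ℝ) : ℂ)
      * (-1 + ((θ n / saddle n : ℝ) : ℂ) * Complex.I)) Filter.atTop
      (nhds (((x * s : ℝ) : ℂ) * (-1 + ((0 : ℝ) : ℂ) * Complex.I))) :=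
    ((Complex.continuous_ofReal.tendsto _).comp h2).mul
      ((((Complex.continuous_ofReal.tendsto _).comp hθ).mul_const _).const_add _)
  have h4 := (Complex.continuous_exp.tendsto _).comp h3
  have h5 : Complex.exp (((x * s : ℝ) : ℂ) * (-1 + ((0 : ℝ) : ℂ) * Complex.I))
      = ((Real.exp (-x) ^ s : ℝ) : ℂ) := by
    rw [← Real.exp_nat_mul]
    push_cast
    congr 1
    ring
  rw [h5] at h4
  refine h4.congr' ?_
  filter_upwards [eventually_saddle_pos] with n hn
  have hn' : (saddle n : ℂ) ≠ 0 := by exact_mod_cast hn.ne'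
  rw [circlePt_pow, Function.comp]
  congr 1
  push_cast
  field_simp

lemma tendsto_saddle_mul_hookRatio (h : ℕ) {θ : ℕ → ℝ}
    (hθ : Filter.Tendsto (fun n => θ n / saddle n) Filter.atTop (nhds 0)) :
    Filter.Tendsto (fun n => (saddle n : ℂ) * hookRatio h n (saddle n) (θ n)) Filter.atTop
      (nhds (hookConst h : ℂ)) := by
  have hterm : ∀ x ∈ hookPatterns h, Filter.Tendsto (fun n => saddle n •
      ∑ j ∈ range (n + 1 - x.1), circlePt (saddle n) (θ n) ^ (∑ t ∈ x.2, t + j * #x.2)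
        / ∏ k ∈ Ioc j (j + x.1), (1 + circlePt (saddle n) (θ n) ^ k)) Filter.atTop
      (nhds (∫ u in Set.Ioi (0 : ℝ), (hookDensity #x.2 x.1 u : ℂ))) := by
    intro x hx
    refine tendsto_smul_sum_range eventually_saddle_pos tendsto_saddle (fun n => n + 1 - x.1)
      (fun n j => circlePt (saddle n) (θ n) ^ (∑ t ∈ x.2, t + j * #x.2)
        / ∏ k ∈ Ioc j (j + x.1), (1 + circlePt (saddle n) (θ n) ^ k)) _
      (C := ((1 / 4) ^ h)⁻¹) (c := 1) one_pos ?_ ?_ ?_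
    · have h1 := hθ.abs
      rw [abs_zero] at h1
      filter_upwards [eventually_saddle_pos, h1.eventually (gt_mem_nhds (zero_lt_four' ℝ))]
        with n hn hn4 j _
      rw [abs_div, abs_of_pos hn, div_lt_iff₀ hn] at hn4
      exact norm_hookRatio_term_le hx hn (by norm_num) (by norm_num)
        (fun k _ => quarter_le_norm_one_add_circlePt_pow hn4.le k) j
    · intro u hu
      have h1 : Filter.Tendsto (fun n => ∏ i ∈ range x.1,
          (1 + circlePt (saddle n) (θ n) ^ (i + 1 + ⌊u / saddle n⌋₊ * 1))) Filter.atTop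
          (nhds (∏ _i ∈ range x.1, (1 + ((Real.exp (-u) ^ 1 : ℝ) : ℂ)))) :=
        tendsto_finsetProd _ fun i _ => (tendsto_circlePt_pow hθ hu 1 (i + 1)).const_add 1
      have h2 : (∏ _i ∈ range x.1, (1 + ((Real.exp (-u) ^ 1 : ℝ) : ℂ))) ≠ 0 := by
        rw [Finset.prod_const]
        refine pow_ne_zero _ ?_
        have : 0 < 1 + Real.exp (-u) ^ 1 := by positivity
        exact_mod_cast this.ne'
      have h3 := (tendsto_circlePt_pow hθ hu #x.2 (∑ t ∈ x.2, t)).div h1 h2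
      have h4 : ((Real.exp (-u) ^ #x.2 : ℝ) : ℂ)
          / ∏ _i ∈ range x.1, (1 + ((Real.exp (-u) ^ 1 : ℝ) : ℂ)) = hookDensity #x.2 x.1 u := by
        rw [Finset.prod_const, hookDensity]
        simp
      rw [h4] at h3
      refine h3.congr fun n => congrArg₂ (· / ·) rfl ?_
      rw [← Finset.Ico_add_one_add_one_eq_Ioc, Finset.prod_Ico_eq_prod_range,
        show ⌊u / saddle n⌋₊ + x.1 + 1 - (⌊u / saddle n⌋₊ + 1) = x.1 by omega]
      refine Finset.prod_congr rfl fun i _ => ?_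
      congr 2
      ring
    · have h1 : Filter.Tendsto (fun n : ℕ => n * saddle n - saddle n * x.1) Filter.atTop
          Filter.atTop :=
        tendsto_natCast_mul_saddle.atTop_add (tendsto_saddle.mul_const (x.1 : ℝ)).neg
      refine Filter.tendsto_atTop_mono' _ ?_ h1
      filter_upwards [eventually_saddle_pos] with n hn
      have h2 : (n : ℝ) ≤ ((n + 1 - x.1 : ℕ) : ℝ) + x.1 := by
        exact_mod_cast (by omega : n ≤ n + 1 - x.1 + x.1)
      nlinarith
  have h1 := tendsto_finsetSum _ hterm
  have h2 : (hookConst h : ℂ)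
      = ∑ x ∈ hookPatterns h, ∫ u in Set.Ioi (0 : ℝ), (hookDensity #x.2 x.1 u : ℂ) := by
    rw [hookConst, Complex.ofReal_sum]
    exact Finset.sum_congr rfl fun x _ => integral_ofReal.symm
  rw [h2]
  refine h1.congr fun n => ?_
  rw [hookRatio, Finset.mul_sum]
  exact Finset.sum_congr rfl fun x _ => Complex.real_smul

lemma norm_prod_sub_prod_le_sum {ι : Type*} (s : Finset ι) (a b : ι → ℂ)
    (ha : ∀ i ∈ s, ‖a i‖ ≤ 1) (hb : ∀ i ∈ s, ‖b i‖ ≤ 1) :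
    ‖∏ i ∈ s, a i - ∏ i ∈ s, b i‖ ≤ ∑ i ∈ s, ‖a i - b i‖ := by
  classical
  induction s using Finset.induction_on with
  | empty => simp
  | insert i s hi ih =>
    rw [Finset.prod_insert hi, Finset.prod_insert hi, Finset.sum_insert hi]
    have h1 := ih (fun j hj => ha j (Finset.mem_insert_of_mem hj))
      (fun j hj => hb j (Finset.mem_insert_of_mem hj))
    have h2 : ‖∏ j ∈ s, a j‖ ≤ 1 := by
      rw [norm_prod]
      exact Finset.prod_le_one (fun _ _ => norm_nonneg _)
        fun j hj => ha j (Finset.mem_insert_of_mem hj)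
    have h3 := hb i (Finset.mem_insert_self i s)
    have h4 : a i * ∏ j ∈ s, a j - b i * ∏ j ∈ s, b j
        = (a i - b i) * ∏ j ∈ s, a j + b i * (∏ j ∈ s, a j - ∏ j ∈ s, b j) := by ring
    rw [h4]
    refine (norm_add_le _ _).trans (add_le_add ?_ ?_)
    · rw [norm_mul]
      exact mul_le_of_le_one_right (norm_nonneg _) h2
    · rw [norm_mul]
      exact (mul_le_of_le_one_left (norm_nonneg _) h3).trans h1

lemma norm_exp_mul_I_sub_le (y : ℝ) :
    ‖Complex.exp (y * Complex.I) - (1 + y * Complex.I - y ^ 2 / 2)‖ ≤ 4 * |y| ^ 3 := by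
  have hn : ‖(y * Complex.I : ℂ)‖ = |y| := by simp
  rcases le_or_gt |y| 1 with hy | hy
  · have h := Complex.exp_bound (x := y * Complex.I) (by rw [hn]; exact hy) (n := 3) (by norm_num)
    rw [hn] at h
    have h1 : ∑ m ∈ range 3, (y * Complex.I : ℂ) ^ m / (Nat.factorial m : ℂ)
        = 1 + y * Complex.I - y ^ 2 / 2 := by
      rw [Finset.sum_range_succ, Finset.sum_range_succ, Finset.sum_range_one,
        mul_pow _ _ 2, Complex.I_sq]
      norm_num
      ring
    rw [h1] at h
    refine h.trans ?_
    norm_num [Nat.factorial]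
    have : 0 ≤ |y| ^ 3 := by positivity
    linarith
  · have h1 : ‖(1 + y * Complex.I - y ^ 2 / 2 : ℂ)‖ ≤ 1 + |y| + |y| ^ 2 / 2 := by
      refine (norm_sub_le _ _).trans (add_le_add ((norm_add_le _ _).trans_eq ?_) (le_of_eq ?_))
      · rw [hn, norm_one]
      · simp
    refine (norm_sub_le _ _).trans ?_
    rw [Complex.norm_exp_ofReal_mul_I]
    have h2 : 1 ≤ |y| ^ 3 := one_le_pow₀ hy.le
    have h3 : |y| ≤ |y| ^ 3 := le_self_pow₀ hy.le (by norm_num)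
    have h4 : |y| ^ 2 ≤ |y| ^ 3 := pow_le_pow_right₀ hy.le (by norm_num)
    linarith

/-- The characteristic function of a centred Bernoulli variable. -/
noncomputable def bernoulliChar (p u : ℝ) : ℂ :=
  (1 - p) * Complex.exp ((-(p * u) : ℝ) * Complex.I)
    + p * Complex.exp (((1 - p) * u : ℝ) * Complex.I)

lemma norm_bernoulliChar_le {p : ℝ} (hp : 0 ≤ p) (hp1 : p ≤ 1) (u : ℝ) :
    ‖bernoulliChar p u‖ ≤ 1 := by
  refine (norm_add_le _ _).trans_eq ?_
  rw [norm_mul, norm_mul, Complex.norm_exp_ofReal_mul_I, Complex.norm_exp_ofReal_mul_I,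
    ← Complex.ofReal_one, ← Complex.ofReal_sub, Complex.norm_real, Complex.norm_real,
    Real.norm_of_nonneg hp, Real.norm_of_nonneg (sub_nonneg.2 hp1)]
  ring

lemma bernoulliChar_eq (p u : ℝ) :
    bernoulliChar p u = Complex.exp (-(p * u * Complex.I))
      * (1 + p * (Complex.exp (u * Complex.I) - 1)) := by
  have h1 : Complex.exp (((1 - p) * u : ℝ) * Complex.I)
      = Complex.exp (-(p * u * Complex.I)) * Complex.exp (u * Complex.I) := by
    rw [← Complex.exp_add]
    push_cast
    congr 1
    ring
  rw [bernoulliChar, h1]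
  push_cast
  ring_nf

lemma norm_bernoulliChar_sub_exp_le {p : ℝ} (hp : 0 ≤ p) (hp1 : p ≤ 1) (u : ℝ) :
    ‖bernoulliChar p u - Real.exp (-(p * (1 - p) * u ^ 2 / 2))‖ ≤ p * (4 * |u| ^ 3 + u ^ 4) := by
  have hq : 0 ≤ 1 - p := sub_nonneg.2 hp1
  set w : ℝ := p * (1 - p) * u ^ 2 / 2 with hw
  have hw0 : 0 ≤ w := by positivity
  have h1 := norm_exp_mul_I_sub_le (-(p * u))
  have h2 := norm_exp_mul_I_sub_le ((1 - p) * u)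
  rw [abs_neg, abs_mul, abs_of_nonneg hp] at h1
  rw [abs_mul, abs_of_nonneg hq] at h2
  have h3 : |1 - w - Real.exp (-w)| ≤ w ^ 2 := by
    have h4 := Real.add_one_le_exp (-w)
    have h5 : Real.exp (-w) * (1 + w) ≤ 1 := by
      have h6 := Real.add_one_le_exp w
      have h7 : Real.exp (-w) * Real.exp w = 1 := by rw [← Real.exp_add]; simp
      nlinarith [Real.exp_pos (-w)]
    rw [abs_le]
    constructor
    · have : (1 - w + w ^ 2 - Real.exp (-w)) * (1 + w) ≥ 0 := by nlinarith [pow_nonneg hw0 3]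
      have := nonneg_of_mul_nonneg_left this (by linarith)
      linarith
    · nlinarith
  have h4 : bernoulliChar p u - Real.exp (-w)
      = (1 - p) * (Complex.exp ((-(p * u) : ℝ) * Complex.I)
          - (1 + (-(p * u) : ℝ) * Complex.I - (-(p * u) : ℝ) ^ 2 / 2))
        + p * (Complex.exp (((1 - p) * u : ℝ) * Complex.I)
          - (1 + ((1 - p) * u : ℝ) * Complex.I - ((1 - p) * u : ℝ) ^ 2 / 2))
        + ((1 - w - Real.exp (-w) : ℝ) : ℂ) := by
    rw [bernoulliChar, hw]
    push_cast
    ring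
  rw [h4]
  refine (norm_add₃_le).trans ?_
  have hqn : ‖(1 - p : ℂ)‖ = 1 - p := by
    rw [← Complex.ofReal_one, ← Complex.ofReal_sub, Complex.norm_real, Real.norm_of_nonneg hq]
  rw [norm_mul, norm_mul, hqn, Complex.norm_real, Complex.norm_real, Real.norm_of_nonneg hp,
    Real.norm_eq_abs]
  have h5 := mul_le_mul_of_nonneg_left h1 hq
  have h6 := mul_le_mul_of_nonneg_left h2 hp
  have h7 : (1 - p) * (4 * (p * |u|) ^ 3) + p * (4 * ((1 - p) * |u|) ^ 3) ≤ p * (4 * |u| ^ 3) := by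
    have : 0 ≤ p * |u| ^ 3 := by positivity
    have h8 : (1 - p) * (p ^ 2 + (1 - p) ^ 2) ≤ 1 := by nlinarith [mul_nonneg hp hq]
    nlinarith
  have h8 : w ^ 2 ≤ p * u ^ 4 := by
    have h9 : w ^ 2 = p * u ^ 4 * (p * (1 - p) ^ 2 / 4) := by rw [hw]; ring
    rw [h9]
    refine mul_le_of_le_one_right (by positivity) ?_
    nlinarith [mul_nonneg hp hq]
  linarith

lemma one_add_circlePt_pow_div (ε θ : ℝ) (k : ℕ) :
    (1 + circlePt ε θ ^ k) / (1 + Real.exp (-ε * k))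
      = 1 + fermi (ε * k) * (Complex.exp ((k * θ : ℝ) * Complex.I) - 1) := by
  have h1 : circlePt ε θ ^ k = Real.exp (-ε * k) * Complex.exp ((k * θ : ℝ) * Complex.I) := by
    rw [circlePt_pow, Complex.ofReal_exp, ← Complex.exp_add]
    push_cast
    congr 1
    ring
  have h2 : (1 + Real.exp (-ε * k) : ℂ) ≠ 0 := by
    have : 0 < 1 + Real.exp (-ε * k) := by positivity
    exact_mod_cast this.ne'
  rw [h1, fermi, show -(ε * k) = -ε * k by ring]
  generalize Real.exp (-ε * k) = e at h2
  push_cast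
  field_simp
  ring

lemma distinctChar_eq_mul_prod (n : ℕ) (ε θ : ℝ) :
    distinctChar n ε θ
      = Complex.exp (((θ * (∑ k ∈ Icc 1 n, k * fermi (ε * k) - n) : ℝ) : ℂ) * Complex.I)
        * ∏ k ∈ Icc 1 n, bernoulliChar (fermi (ε * k)) (k * θ) := by
  simp_rw [bernoulliChar_eq, Finset.prod_mul_distrib, ← Complex.exp_sum, ← mul_assoc,
    ← Complex.exp_add]
  rw [distinctChar]
  congr 1
  · congr 1
    push_cast
    rw [mul_sub, sub_mul, Finset.mul_sum, Finset.sum_mul, Finset.sum_neg_distrib]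
    rw [show ∑ k ∈ Icc 1 n, (fermi (ε * k) : ℂ) * (k * θ) * Complex.I
      = ∑ k ∈ Icc 1 n, (θ : ℂ) * (k * fermi (ε * k)) * Complex.I from
        Finset.sum_congr rfl fun k _ => by ring]
    ring
  · exact Finset.prod_congr rfl fun k _ => one_add_circlePt_pow_div ε θ k

lemma sum_pow_mul_fermi_le (m n : ℕ) {ε : ℝ} (hε : 0 < ε) (hε1 : ε ≤ 1) :
    ε ^ (m + 1) * ∑ k ∈ Icc 1 n, (k : ℝ) ^ m * fermi (ε * k)
      ≤ 3 * (2 ^ m * (Nat.factorial m : ℝ)) := by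
  have h1 : ∀ k : ℕ, ε ^ m * ((k : ℝ) ^ m * fermi (ε * k))
      ≤ 2 ^ m * (Nat.factorial m : ℝ) * Real.exp (-(1 / 2) * (ε * k)) := by
    intro k
    have hx : 0 ≤ ε * k / 2 := by positivity
    have h2 := Real.pow_div_factorial_le_exp _ hx m
    rw [div_le_iff₀ (by positivity)] at h2
    have h3 : Real.exp (-(ε * k)) = Real.exp (-(1 / 2) * (ε * k)) * Real.exp (-(ε * k / 2)) := by
      rw [← Real.exp_add]
      ring_nf
    have h4 : Real.exp (-(ε * k / 2)) * Real.exp (ε * k / 2) = 1 := by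
      rw [← Real.exp_add]
      simp
    have h5 : (ε * k / 2) ^ m * Real.exp (-(ε * k / 2)) ≤ (Nat.factorial m : ℝ) := by
      calc (ε * k / 2) ^ m * Real.exp (-(ε * k / 2))
          ≤ Real.exp (ε * k / 2) * (Nat.factorial m : ℝ) * Real.exp (-(ε * k / 2)) := by gcongr
        _ = (Nat.factorial m : ℝ) * (Real.exp (-(ε * k / 2)) * Real.exp (ε * k / 2)) := by ring
        _ = _ := by rw [h4, mul_one]
    calc ε ^ m * ((k : ℝ) ^ m * fermi (ε * k))
        ≤ ε ^ m * ((k : ℝ) ^ m * Real.exp (-(ε * k))) := by gcongr; exact fermi_le_exp _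
      _ = 2 ^ m * ((ε * k / 2) ^ m * Real.exp (-(ε * k / 2))) * Real.exp (-(1 / 2) * (ε * k)) := by
          rw [h3, div_pow, mul_pow]
          field_simp
      _ ≤ _ := by gcongr
  have h2 := sum_range_exp_le (c := 1 / 2) (by norm_num) hε (n + 1)
  have h3 : ∑ k ∈ Icc 1 n, Real.exp (-(1 / 2) * (ε * k))
      ≤ ∑ k ∈ range (n + 1), Real.exp (-(1 / 2) * (ε * k)) := by
    refine Finset.sum_le_sum_of_subset_of_nonneg (fun k hk => ?_) fun _ _ _ => (Real.exp_pos _).le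
    rw [Finset.mem_Icc] at hk
    rw [Finset.mem_range]
    omega
  have h4 : ε ^ m * ∑ k ∈ Icc 1 n, (k : ℝ) ^ m * fermi (ε * k)
      ≤ 2 ^ m * (Nat.factorial m : ℝ) * (1 + 1 / (1 / 2 * ε)) := by
    rw [Finset.mul_sum]
    refine (Finset.sum_le_sum fun k _ => h1 k).trans ?_
    rw [← Finset.mul_sum]
    exact mul_le_mul_of_nonneg_left (h3.trans h2) (by positivity)
  have h5 : ε * (1 + 1 / (1 / 2 * ε)) ≤ 3 := by
    have : ε * (1 + 1 / (1 / 2 * ε)) = ε + 2 := by field_simp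
    linarith
  calc ε ^ (m + 1) * ∑ k ∈ Icc 1 n, (k : ℝ) ^ m * fermi (ε * k)
      = ε * (ε ^ m * ∑ k ∈ Icc 1 n, (k : ℝ) ^ m * fermi (ε * k)) := by ring
    _ ≤ ε * (2 ^ m * (Nat.factorial m : ℝ) * (1 + 1 / (1 / 2 * ε))) := by gcongr
    _ = ε * (1 + 1 / (1 / 2 * ε)) * (2 ^ m * (Nat.factorial m : ℝ)) := by ring
    _ ≤ _ := by gcongr

/-- The width of the peak of `distinctChar` at the saddle point. -/
noncomputable def peakWidth (n : ℕ) : ℝ := saddle n * √(saddle n)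

lemma peakWidth_pos {n : ℕ} (hn : 0 < saddle n) : 0 < peakWidth n :=
  mul_pos hn (Real.sqrt_pos.2 hn)

lemma peakWidth_sq {n : ℕ} (hn : 0 < saddle n) : peakWidth n ^ 2 = saddle n ^ 3 := by
  rw [peakWidth, mul_pow, Real.sq_sqrt hn.le]
  ring

lemma tendsto_sqrt_saddle : Filter.Tendsto (fun n => √(saddle n)) Filter.atTop (nhds 0) := by
  simpa using tendsto_saddle.sqrt

/-- The central limit theorem for the size of the random partition. -/
lemma tendsto_distinctChar (t : ℝ) :
    Filter.Tendsto (fun n => distinctChar n (saddle n) (t * peakWidth n)) Filter.atTop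
      (nhds (Real.exp (-(Real.pi ^ 2 / 12) * t ^ 2) : ℂ)) := by
  have hphase : Filter.Tendsto (fun n => Complex.exp (((t * peakWidth n *
      (∑ k ∈ Icc 1 n, k * fermi (saddle n * k) - n) : ℝ) : ℂ) * Complex.I)) Filter.atTop
      (nhds 1) := by
    have h1 := (tendsto_sqrt_saddle.mul tendsto_sum_mul_fermi_sub).const_mul t
    rw [mul_zero, mul_zero] at h1
    have h2 := (Complex.continuous_exp.tendsto _).comp
      (((Complex.continuous_ofReal.tendsto _).comp h1).mul_const Complex.I)
    simp only [Complex.ofReal_zero, zero_mul, Complex.exp_zero] at h2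
    refine h2.congr fun n => ?_
    simp only [Function.comp]
    congr 3
    rw [peakWidth]
    ring
  have hgauss : Filter.Tendsto (fun n => ∏ k ∈ Icc 1 n, ((Real.exp (-(fermi (saddle n * k)
      * (1 - fermi (saddle n * k)) * (k * (t * peakWidth n)) ^ 2 / 2)) : ℝ) : ℂ)) Filter.atTop
      (nhds (Real.exp (-(Real.pi ^ 2 / 12) * t ^ 2) : ℂ)) := by
    have h1 := tendsto_sum_sq_mul_fermi.const_mul (-(t ^ 2 / 2))
    rw [show -(t ^ 2 / 2) * (Real.pi ^ 2 / 6) = -(Real.pi ^ 2 / 12) * t ^ 2 by ring] at h1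
    have h2 := (Complex.continuous_ofReal.tendsto _).comp ((Real.continuous_exp.tendsto _).comp h1)
    refine h2.congr' ?_
    filter_upwards [eventually_saddle_pos] with n hn
    simp only [Function.comp]
    rw [← Complex.ofReal_prod, ← Real.exp_sum, ← peakWidth_sq hn, Finset.mul_sum, Finset.mul_sum]
    congr 2
    refine Finset.sum_congr rfl fun k _ => ?_
    ring
  have hdiff : Filter.Tendsto (fun n => ∏ k ∈ Icc 1 n, bernoulliChar (fermi (saddle n * k))
      (k * (t * peakWidth n)) - ∏ k ∈ Icc 1 n, ((Real.exp (-(fermi (saddle n * k)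
      * (1 - fermi (saddle n * k)) * (k * (t * peakWidth n)) ^ 2 / 2)) : ℝ) : ℂ)) Filter.atTop
      (nhds 0) := by
    have h0 : Filter.Tendsto (fun n => 4 * |t| ^ 3 * (3 * (2 ^ 3 * (Nat.factorial 3 : ℝ)))
        * √(saddle n) + t ^ 4 * (3 * (2 ^ 4 * (Nat.factorial 4 : ℝ))) * saddle n) Filter.atTop
        (nhds 0) := by
      simpa using (tendsto_sqrt_saddle.const_mul _).add (tendsto_saddle.const_mul _)
    refine squeeze_zero_norm' ?_ h0
    filter_upwards [eventually_saddle_pos, tendsto_saddle.eventually (ge_mem_nhds one_pos)]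
      with n hn hn1
    have hw := peakWidth_pos hn
    refine (norm_prod_sub_prod_le_sum _ _ _ (fun k _ => norm_bernoulliChar_le (fermi_pos _).le
      (fermi_lt_one _).le _) fun k _ => ?_).trans ?_
    · rw [Complex.norm_real, Real.norm_of_nonneg (Real.exp_pos _).le, Real.exp_le_one_iff,
        Left.neg_nonpos_iff]
      have := fermi_mul_one_sub_nonneg (saddle n * k)
      positivity
    refine (Finset.sum_le_sum fun k _ => norm_bernoulliChar_sub_exp_le (fermi_pos _).le
      (fermi_lt_one _).le _).trans ?_
    have h1 := sum_pow_mul_fermi_le 3 n hn hn1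
    have h2 := sum_pow_mul_fermi_le 4 n hn hn1
    set ε := saddle n
    have hs : √ε ^ 2 = ε := Real.sq_sqrt hn.le
    have hw3 : peakWidth n ^ 3 = ε ^ 4 * √ε := by
      change (ε * √ε) ^ 3 = _
      calc (ε * √ε) ^ 3 = ε ^ 3 * √ε ^ 2 * √ε := by ring
        _ = _ := by rw [hs]; ring
    have hw4 : peakWidth n ^ 4 = ε ^ 5 * ε := by
      change (ε * √ε) ^ 4 = _
      calc (ε * √ε) ^ 4 = ε ^ 4 * (√ε ^ 2) ^ 2 := by ring
        _ = _ := by rw [hs]; ring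
    have h3 : ∑ k ∈ Icc 1 n, fermi (ε * k) * (4 * |k * (t * peakWidth n)| ^ 3
          + (k * (t * peakWidth n)) ^ 4)
        = 4 * |t| ^ 3 * (ε ^ (3 + 1) * ∑ k ∈ Icc 1 n, (k : ℝ) ^ 3 * fermi (ε * k)) * √ε
          + t ^ 4 * (ε ^ (4 + 1) * ∑ k ∈ Icc 1 n, (k : ℝ) ^ 4 * fermi (ε * k)) * ε := by
      simp only [Finset.mul_sum, Finset.sum_mul]
      rw [← Finset.sum_add_distrib]
      refine Finset.sum_congr rfl fun k _ => ?_
      rw [abs_mul, abs_mul, Nat.abs_cast, abs_of_pos hw, mul_pow, mul_pow, mul_pow (k : ℝ),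
        mul_pow t, hw3, hw4]
      ring
    rw [h3]
    have := Real.sqrt_nonneg ε
    gcongr
  have h := hphase.mul (hdiff.add hgauss)
  simp only [zero_add, one_mul, sub_add_cancel] at h
  refine h.congr fun n => ?_
  rw [distinctChar_eq_mul_prod]

lemma norm_one_add_mul_exp_sub_one_le {p : ℝ} (u : ℝ) :
    ‖(1 + p * (Complex.exp ((u : ℝ) * Complex.I) - 1) : ℂ)‖
      ≤ Real.exp (-(p * (1 - p) * (1 - Real.cos u))) := by
  have h1 : ‖(1 + p * (Complex.exp ((u : ℝ) * Complex.I) - 1) : ℂ)‖ ^ 2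
      = 1 - 2 * (p * (1 - p) * (1 - Real.cos u)) := by
    rw [← Complex.normSq_eq_norm_sq, Complex.normSq_apply]
    simp [Complex.exp_ofReal_mul_I_re, Complex.exp_ofReal_mul_I_im]
    have := Real.sin_sq_add_cos_sq u
    linear_combination p ^ 2 * this
  have h2 := Real.add_one_le_exp (-(2 * (p * (1 - p) * (1 - Real.cos u))))
  refine abs_le_of_sq_le_sq' (a := ‖(1 + p * (Complex.exp ((u : ℝ) * Complex.I) - 1) : ℂ)‖) ?_
    (Real.exp_pos _).le |>.2
  rw [h1, ← Real.exp_nat_mul]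
  push_cast
  rw [show (2 : ℝ) * -(p * (1 - p) * (1 - Real.cos u))
    = -(2 * (p * (1 - p) * (1 - Real.cos u))) by ring]
  linarith

lemma fermi_mul_one_sub_ge {x : ℝ} (hx : 0 ≤ x) (hx1 : x ≤ 1) :
    1 / 12 ≤ fermi x * (1 - fermi x) := by
  rw [one_sub_fermi, fermi, div_mul_div_comm, mul_one, div_le_div_iff₀ (by norm_num) (by positivity)]
  have h1 : Real.exp (-1) ≤ Real.exp (-x) := Real.exp_le_exp.2 (by linarith)
  have h2 : Real.exp (-x) ≤ 1 := by simpa using hx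
  have h3 : Real.exp (-1) * Real.exp 1 = 1 := by rw [← Real.exp_add]; simp
  have h4 : Real.exp 1 < 3 := by linarith [Real.exp_one_lt_d9]
  have h5 : 1 / 3 ≤ Real.exp (-1) := by nlinarith [Real.exp_pos (-1)]
  nlinarith

lemma norm_distinctChar_le {n K : ℕ} (hK : K ≤ n) {ε : ℝ} (hε : 0 ≤ ε) (hKε : ε * K ≤ 1) (θ : ℝ) :
    ‖distinctChar n ε θ‖ ≤ Real.exp (-(1 / 12) * ∑ k ∈ Icc 1 K, (1 - Real.cos (k * θ))) := by
  have h0 : ‖Complex.exp (-(n * θ * Complex.I))‖ = 1 := by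
    rw [show -(n * θ * Complex.I) = ((-(n * θ) : ℝ) : ℂ) * Complex.I by push_cast; ring]
    exact Complex.norm_exp_ofReal_mul_I _
  rw [distinctChar, norm_mul, h0, one_mul, norm_prod]
  have h1 : ∀ k ∈ Icc 1 n, ‖(1 + circlePt ε θ ^ k) / (1 + Real.exp (-ε * k))‖
      ≤ Real.exp (-(fermi (ε * k) * (1 - fermi (ε * k)) * (1 - Real.cos (k * θ)))) := by
    intro k _
    rw [one_add_circlePt_pow_div]
    exact norm_one_add_mul_exp_sub_one_le _
  refine (Finset.prod_le_prod (fun _ _ => norm_nonneg _) h1).trans ?_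
  rw [← Real.exp_sum, Real.exp_le_exp, Finset.sum_neg_distrib, neg_mul, neg_le_neg_iff,
    Finset.mul_sum]
  have hcos : ∀ k : ℕ, 0 ≤ 1 - Real.cos (k * θ) := fun k => sub_nonneg.2 (Real.cos_le_one _)
  refine le_trans (Finset.sum_le_sum fun k hk => ?_)
    (Finset.sum_le_sum_of_subset_of_nonneg (Finset.Icc_subset_Icc_right hK) fun k _ _ =>
      mul_nonneg (fermi_mul_one_sub_nonneg _) (hcos k))
  refine mul_le_mul_of_nonneg_right (fermi_mul_one_sub_ge (by positivity) ?_) (hcos k)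
  have : (k : ℝ) ≤ K := by exact_mod_cast (Finset.mem_Icc.1 hk).2
  nlinarith

lemma cube_div_three_le_sum_sq (K : ℕ) : (K : ℝ) ^ 3 / 3 ≤ ∑ k ∈ Icc 1 K, (k : ℝ) ^ 2 := by
  induction K with
  | zero => simp
  | succ K ih =>
    rw [Finset.sum_Icc_succ_top (by omega)]
    push_cast
    have : (0 : ℝ) ≤ K := by positivity
    nlinarith

lemma two_div_pi_sq_mul_le_one_sub_cos {u : ℝ} (hu : |u| ≤ Real.pi) :
    u ^ 2 / 5 ≤ 1 - Real.cos u := by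
  have h1 := Real.cos_le_one_sub_mul_cos_sq hu
  have h2 : (1 : ℝ) / 5 ≤ 2 / Real.pi ^ 2 := by
    rw [div_le_div_iff₀ (by norm_num) (by positivity)]
    nlinarith [Real.pi_lt_d2, Real.pi_pos]
  nlinarith [sq_nonneg u]

lemma norm_distinctChar_le_of_abs_le {n : ℕ} {ε θ : ℝ} (hε : 0 < ε) (hε1 : ε ≤ 1 / 8)
    (hn : 1 ≤ n * ε) (hθ : |θ| ≤ 4 * ε) :
    ‖distinctChar n ε θ‖ ≤ Real.exp (-(θ ^ 2 / ε ^ 3 / 92160)) := by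
  set K := ⌊1 / (4 * ε)⌋₊ with hKdef
  have hK1 : (K : ℝ) * (4 * ε) ≤ 1 := by
    have h := Nat.floor_le (a := 1 / (4 * ε)) (by positivity)
    rwa [le_div_iff₀ (by positivity)] at h
  have hK2 : 1 / 8 ≤ K * ε := by
    have h := Nat.lt_floor_add_one (1 / (4 * ε))
    rw [div_lt_iff₀ (by positivity)] at h
    rw [← hKdef] at h
    nlinarith
  have hKn : K ≤ n := by
    have : (K : ℝ) ≤ n := by
      by_contra! hlt
      nlinarith
    exact_mod_cast this
  refine (norm_distinctChar_le hKn hε.le (by nlinarith) θ).trans (Real.exp_le_exp.2 ?_)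
  have h1 : ∑ k ∈ Icc 1 K, ((k : ℝ) ^ 2 * (θ ^ 2 / 5)) ≤ ∑ k ∈ Icc 1 K, (1 - Real.cos (k * θ)) := by
    refine Finset.sum_le_sum fun k hk => ?_
    have hk' : (k : ℝ) ≤ K := by exact_mod_cast (Finset.mem_Icc.1 hk).2
    have h2 := two_div_pi_sq_mul_le_one_sub_cos (u := k * θ) (by
      rw [abs_mul, Nat.abs_cast]
      have h3 : (k : ℝ) * |θ| ≤ K * (4 * ε) := by gcongr
      linarith [Real.pi_gt_three])
    linarith
  rw [← Finset.sum_mul] at h1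
  have h2 := cube_div_three_le_sum_sq K
  have h3 : (1 / 8 / ε) ^ 3 ≤ (K : ℝ) ^ 3 := by
    gcongr
    rwa [div_le_iff₀ hε]
  have h4 : (1 / 8 / ε) ^ 3 / 3 * (θ ^ 2 / 5) ≤ ∑ k ∈ Icc 1 K, (1 - Real.cos (k * θ)) := by
    refine le_trans ?_ h1
    gcongr
    linarith
  have h5 : (1 / 8 / ε) ^ 3 / 3 * (θ ^ 2 / 5) = 12 * (θ ^ 2 / ε ^ 3 / 92160) := by
    field_simp
    ring
  linarith

lemma sum_cos_le {θ : ℝ} (hθ0 : θ ≠ 0) (hθ : |θ| ≤ Real.pi) (K : ℕ) :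
    ∑ k ∈ Icc 1 K, Real.cos (k * θ) ≤ Real.pi / |θ| := by
  set r : ℂ := Complex.exp (θ * Complex.I) with hr
  have hr1 : ‖r‖ = 1 := Complex.norm_exp_ofReal_mul_I θ
  have hpos : 0 < |θ| := abs_pos.2 hθ0
  have h1 : ‖r - 1‖ ^ 2 = 2 * (1 - Real.cos θ) := by
    rw [← Complex.normSq_eq_norm_sq, Complex.normSq_apply, hr]
    simp [Complex.exp_ofReal_mul_I_re, Complex.exp_ofReal_mul_I_im]
    linear_combination Real.sin_sq_add_cos_sq θ
  have h2 : 2 * |θ| / Real.pi ≤ ‖r - 1‖ := by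
    refine (abs_le_of_sq_le_sq' ?_ (norm_nonneg _)).2
    rw [h1, div_pow, mul_pow, sq_abs]
    have := Real.cos_le_one_sub_mul_cos_sq hθ
    have h3 : 2 ^ 2 * θ ^ 2 / Real.pi ^ 2 = 2 * (2 / Real.pi ^ 2 * θ ^ 2) := by ring
    linarith
  have h3 : ∑ k ∈ Icc 1 K, Real.cos (k * θ) = (r * ∑ k ∈ range K, r ^ k).re := by
    rw [Finset.mul_sum, Complex.re_sum, ← Finset.Ico_add_one_right_eq_Icc,
      Finset.sum_Ico_eq_sum_range]
    refine Finset.sum_congr rfl fun k _ => ?_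
    rw [← pow_succ', hr, ← Complex.exp_nat_mul,
      show ((k + 1 : ℕ) : ℂ) * (θ * Complex.I) = (((1 + k : ℕ) * θ : ℝ) : ℂ) * Complex.I by
        push_cast; ring, Complex.exp_ofReal_mul_I_re]
  rw [h3]
  refine (Complex.re_le_norm _).trans ?_
  rw [norm_mul, hr1, one_mul]
  have h4 : ‖∑ k ∈ range K, r ^ k‖ * ‖r - 1‖ ≤ 2 := by
    rw [← norm_mul, geom_sum_mul]
    refine (norm_sub_le _ _).trans ?_
    rw [norm_pow, hr1, norm_one]
    norm_num
  have h5 : ‖∑ k ∈ range K, r ^ k‖ * (2 * |θ| / Real.pi) ≤ 2 :=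
    (mul_le_mul_of_nonneg_left h2 (norm_nonneg _)).trans h4
  rw [le_div_iff₀ hpos]
  have h6 := mul_le_mul_of_nonneg_right h5 Real.pi_pos.le
  have h7 : ‖∑ k ∈ range K, r ^ k‖ * (2 * |θ| / Real.pi) * Real.pi
      = 2 * (‖∑ k ∈ range K, r ^ k‖ * |θ|) := by
    field_simp
  linarith

lemma norm_distinctChar_le_of_le_abs {n : ℕ} {ε θ : ℝ} (hε : 0 < ε) (hε1 : ε ≤ 1 / 10)
    (hn : 1 ≤ n * ε) (hθ : 4 * ε ≤ |θ|) (hθπ : |θ| ≤ Real.pi) :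
    ‖distinctChar n ε θ‖ ≤ Real.exp (-(1 / 120) * ε⁻¹) := by
  set K := ⌊ε⁻¹⌋₊ with hKdef
  have hi : ε * ε⁻¹ = 1 := mul_inv_cancel₀ hε.ne'
  have hi0 : 0 < ε⁻¹ := inv_pos.2 hε
  have hK1 : (K : ℝ) ≤ ε⁻¹ := Nat.floor_le hi0.le
  have hK2 : ε⁻¹ < K + 1 := Nat.lt_floor_add_one ε⁻¹
  have hKn : K ≤ n := by
    have : (K : ℝ) ≤ n := by
      by_contra! hlt
      nlinarith
    exact_mod_cast this
  refine (norm_distinctChar_le hKn hε.le (by nlinarith) θ).trans (Real.exp_le_exp.2 ?_)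
  have hpos : 0 < |θ| := lt_of_lt_of_le (by positivity) hθ
  have h1 := sum_cos_le (abs_pos.1 hpos) hθπ K
  have h2 : Real.pi / |θ| ≤ Real.pi / (4 * ε) := by gcongr
  have h3 : Real.pi / (4 * ε) ≤ 0.79 * ε⁻¹ := by
    rw [div_le_iff₀ (by positivity)]
    have := Real.pi_lt_d2
    nlinarith
  rw [Finset.sum_sub_distrib]
  simp only [Finset.sum_const, Nat.card_Icc, add_tsub_cancel_right, nsmul_eq_mul, mul_one]
  have h4 : 10 ≤ ε⁻¹ := by
    rw [le_inv_comm₀ (by norm_num) hε]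
    linarith
  linarith

lemma measurable_distinctChar (n : ℕ) (ε : ℝ) : Measurable (distinctChar n ε) := by
  unfold distinctChar circlePt
  fun_prop

lemma measurable_hookRatio (h n : ℕ) (ε : ℝ) : Measurable (hookRatio h n ε) := by
  unfold hookRatio circlePt
  fun_prop

/-- The integrand of the circle method in the scale of its peak. -/
noncomputable def peakIntegrand (h n : ℕ) (t : ℝ) : ℂ :=
  (Set.Ioc (-Real.pi / peakWidth n) (Real.pi / peakWidth n)).indicator
    (fun t => distinctChar n (saddle n) (t * peakWidth n)
      * (saddle n * hookRatio h n (saddle n) (t * peakWidth n))) t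

lemma integral_distinctChar_mul_hookRatio (h : ℕ) {n : ℕ} (hn : 0 < saddle n) :
    ∫ θ in (-Real.pi)..Real.pi, distinctChar n (saddle n) θ * hookRatio h n (saddle n) θ
      = √(saddle n) * ∫ t, peakIntegrand h n t := by
  have hw := peakWidth_pos hn
  have h1 := intervalIntegral.integral_comp_mul_right (a := -Real.pi / peakWidth n)
    (b := Real.pi / peakWidth n)
    (fun θ => distinctChar n (saddle n) θ * (saddle n * hookRatio h n (saddle n) θ)) hw.ne'
  have h2 : -Real.pi / peakWidth n ≤ Real.pi / peakWidth n := by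
    have := Real.pi_pos
    gcongr
    linarith
  rw [div_mul_cancel₀ _ hw.ne', div_mul_cancel₀ _ hw.ne', intervalIntegral.integral_of_le h2,
    ← MeasureTheory.integral_indicator measurableSet_Ioc] at h1
  have h3 : ∀ θ, distinctChar n (saddle n) θ * (saddle n * hookRatio h n (saddle n) θ)
      = saddle n * (distinctChar n (saddle n) θ * hookRatio h n (saddle n) θ) := fun θ => by ring
  simp_rw [h3] at h1
  rw [intervalIntegral.integral_const_mul, Complex.real_smul] at h1
  unfold peakIntegrand
  simp_rw [h3]
  rw [h1, ← mul_assoc, ← mul_assoc, ← Complex.ofReal_mul, ← Complex.ofReal_mul]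
  have h4 : √(saddle n) * (peakWidth n)⁻¹ * saddle n = 1 := by
    have := Real.sqrt_pos.2 hn
    rw [peakWidth]
    field_simp
  rw [h4, Complex.ofReal_one, one_mul]

lemma exp_neg_div_le {c u : ℝ} (hc : 1 ≤ c) (hu : 0 ≤ u) : Real.exp (-(u / c)) ≤ c * (1 + u)⁻¹ := by
  have h1 := Real.add_one_le_exp (u / c)
  have hc0 : 0 < c := by linarith
  have h2 : (1 + u) / c ≤ u / c + 1 := by
    rw [add_div, add_comm]
    gcongr
    rw [div_le_one hc0]
    exact hc
  rw [Real.exp_neg, inv_le_comm₀ (Real.exp_pos _) (by positivity), mul_inv, inv_inv, mul_comm]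
  exact h2.trans h1

lemma exists_norm_peakIntegrand_le (h : ℕ) :
    ∃ C : ℝ, ∀ᶠ n in Filter.atTop, ∀ t, ‖peakIntegrand h n t‖ ≤ C * (1 + t ^ 2)⁻¹ := by
  set P : ℝ := 2 * #(hookPatterns h) with hP
  have hP0 : 0 ≤ P := by positivity
  set C₁ : ℝ := P * 4 ^ h * 92160
  set C₂ : ℝ := 11 * P * 2 ^ h * (120 ^ (h + 3) * (Nat.factorial (h + 3) : ℝ))
  have hC₁ : 0 ≤ C₁ := by positivity
  have hC₂ : 0 ≤ C₂ := by positivity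
  refine ⟨C₁ + C₂, ?_⟩
  filter_upwards [eventually_saddle_pos, tendsto_saddle.eventually (ge_mem_nhds
    (show (0 : ℝ) < 1 / 10 by norm_num)), tendsto_natCast_mul_saddle.eventually (Filter.eventually_ge_atTop 1)]
    with n hn hn1 hn2 t
  have hw := peakWidth_pos hn
  have ht0 : 0 ≤ (1 + t ^ 2)⁻¹ := by positivity
  rw [peakIntegrand, Set.indicator_apply]
  split_ifs with ht
  swap
  · rw [norm_zero]
    positivity
  have hsq : (t * peakWidth n) ^ 2 / saddle n ^ 3 = t ^ 2 := by
    rw [mul_pow, peakWidth_sq hn]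
    field_simp
  have htπ : |t * peakWidth n| ≤ Real.pi := by
    rw [abs_mul, abs_of_pos hw, ← le_div_iff₀ hw, abs_le, ← neg_div]
    exact ⟨ht.1.le, ht.2⟩
  set θ := t * peakWidth n
  set ε := saddle n
  rw [norm_mul, norm_mul, Complex.norm_real, Real.norm_of_nonneg hn.le]
  have hR0 : 0 ≤ ε * ‖hookRatio h n ε θ‖ := by positivity
  rcases le_total |θ| (4 * ε) with hθ | hθ
  · have h1 := norm_distinctChar_le_of_abs_le hn (by linarith) hn2 hθ
    have h2 := norm_hookRatio_le_of_abs_le h n hn (by linarith) hθ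
    rw [hsq] at h1
    have h3 := h1.trans (exp_neg_div_le (by norm_num) (sq_nonneg t))
    calc ‖distinctChar n ε θ‖ * (ε * ‖hookRatio h n ε θ‖)
        ≤ 92160 * (1 + t ^ 2)⁻¹ * (P * 4 ^ h) := by gcongr
      _ = C₁ * (1 + t ^ 2)⁻¹ := by ring
      _ ≤ _ := by gcongr; linarith
  · have h1 := norm_distinctChar_le_of_le_abs hn hn1 hn2 hθ htπ
    have h2 := norm_hookRatio_le_pow h n hn (by linarith) θ
    have hi0 : 0 < ε⁻¹ := inv_pos.2 hn
    have hi : 1 ≤ ε⁻¹ := (one_le_inv₀ hn).2 (by linarith)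
    have h3 : 1 + t ^ 2 ≤ 11 * ε⁻¹ ^ 3 := by
      have h4 : t ^ 2 ≤ 10 * ε⁻¹ ^ 3 := by
        rw [← hsq, ← sq_abs, div_eq_mul_inv, inv_pow]
        gcongr
        nlinarith [Real.pi_lt_d2, abs_nonneg θ]
      have h5 : 1 ≤ ε⁻¹ ^ 3 := one_le_pow₀ hi
      linarith
    have h4 := Real.pow_div_factorial_le_exp (ε⁻¹ / 120) (by positivity) (h + 3)
    rw [div_pow, div_div, div_le_iff₀ (by positivity)] at h4
    have h5 : Real.exp (-(1 / 120) * ε⁻¹) * Real.exp (ε⁻¹ / 120) = 1 := by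
      rw [← Real.exp_add, show -(1 / 120) * ε⁻¹ + ε⁻¹ / 120 = 0 by ring, Real.exp_zero]
    have h6 : Real.exp (-(1 / 120) * ε⁻¹) * ε⁻¹ ^ (h + 3)
        ≤ 120 ^ (h + 3) * (Nat.factorial (h + 3) : ℝ) := by
      calc _ ≤ Real.exp (-(1 / 120) * ε⁻¹) * (Real.exp (ε⁻¹ / 120)
            * (120 ^ (h + 3) * (Nat.factorial (h + 3) : ℝ))) := by gcongr
        _ = _ := by rw [← mul_assoc, h5, one_mul]
    have h7 : ‖distinctChar n ε θ‖ * (ε * ‖hookRatio h n ε θ‖) * (1 + t ^ 2) ≤ C₂ := by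
      calc ‖distinctChar n ε θ‖ * (ε * ‖hookRatio h n ε θ‖) * (1 + t ^ 2)
          ≤ Real.exp (-(1 / 120) * ε⁻¹) * (P * (2 * ε⁻¹) ^ h) * (11 * ε⁻¹ ^ 3) := by gcongr
        _ = 11 * P * 2 ^ h * (Real.exp (-(1 / 120) * ε⁻¹) * ε⁻¹ ^ (h + 3)) := by
            rw [mul_pow, pow_add]
            ring
        _ ≤ _ := mul_le_mul_of_nonneg_left h6 (by positivity)
    rw [← div_eq_mul_inv, le_div_iff₀ (by positivity)]
    linarith

lemma tendsto_peakIntegrand (h : ℕ) (t : ℝ) :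
    Filter.Tendsto (fun n => peakIntegrand h n t) Filter.atTop
      (nhds ((Real.exp (-(Real.pi ^ 2 / 12) * t ^ 2) * hookConst h : ℝ) : ℂ)) := by
  have h1 : Filter.Tendsto (fun n => t * peakWidth n / saddle n) Filter.atTop (nhds 0) := by
    have := tendsto_sqrt_saddle.const_mul t
    rw [mul_zero] at this
    refine this.congr' ?_
    filter_upwards [eventually_saddle_pos] with n hn
    rw [peakWidth]
    field_simp
  have h2 := (tendsto_distinctChar t).mul (tendsto_saddle_mul_hookRatio h h1)
  rw [Complex.ofReal_mul]
  refine h2.congr' ?_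
  have h3 : Filter.Tendsto (fun n => |t| * peakWidth n) Filter.atTop (nhds 0) := by
    simpa [peakWidth] using (tendsto_saddle.mul tendsto_sqrt_saddle).const_mul |t|
  filter_upwards [eventually_saddle_pos, h3.eventually (gt_mem_nhds Real.pi_pos)] with n hn hlt
  rw [peakIntegrand, Set.indicator_of_mem]
  have h4 := abs_lt.1 ((lt_div_iff₀ (peakWidth_pos hn)).2 hlt)
  rw [neg_div]
  exact ⟨h4.1, h4.2.le⟩

lemma tendsto_integral_peakIntegrand (h : ℕ) :
    Filter.Tendsto (fun n => ∫ t, peakIntegrand h n t) Filter.atTop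
      (nhds ((√(12 / Real.pi) * hookConst h : ℝ) : ℂ)) := by
  obtain ⟨C, hC⟩ := exists_norm_peakIntegrand_le h
  have h1 := MeasureTheory.tendsto_integral_filter_of_dominated_convergence
    (μ := MeasureTheory.volume) (F := fun n t => peakIntegrand h n t)
    (f := fun t => ((Real.exp (-(Real.pi ^ 2 / 12) * t ^ 2) * hookConst h : ℝ) : ℂ))
    (l := Filter.atTop) (fun t => C * (1 + t ^ 2)⁻¹) ?_ ?_ (integrable_inv_one_add_sq.const_mul C) ?_
  · have h2 : ∫ t : ℝ, ((Real.exp (-(Real.pi ^ 2 / 12) * t ^ 2) * hookConst h : ℝ) : ℂ)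
        = ((√(12 / Real.pi) * hookConst h : ℝ) : ℂ) := by
      refine integral_complex_ofReal.trans (congrArg _ ?_)
      rw [MeasureTheory.integral_mul_const, integral_gaussian,
        show Real.pi / (Real.pi ^ 2 / 12) = 12 / Real.pi by field_simp]
    rwa [h2] at h1
  · refine Filter.Eventually.of_forall fun n => Measurable.aestronglyMeasurable ?_
    refine Measurable.indicator ?_ measurableSet_Ioc
    have h2 := measurable_distinctChar n (saddle n)
    have h3 := measurable_hookRatio h n (saddle n)
    fun_prop
  · filter_upwards [hC] with n hn
    exact Filter.Eventually.of_forall hn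
  · exact Filter.Eventually.of_forall fun t => tendsto_peakIntegrand h t

/-- The order of magnitude of the number of hooks of a given length. -/
noncomputable def saddleSize (n : ℕ) : ℝ :=
  Real.exp (saddle n * n) * (∏ k ∈ Icc 1 n, (1 + Real.exp (-saddle n * k))) / (2 * Real.pi)
    * √(saddle n)

lemma saddleSize_pos {n : ℕ} (hn : 0 < saddle n) : 0 < saddleSize n := by
  have := Real.sqrt_pos.2 hn
  have : 0 < ∏ k ∈ Icc 1 n, (1 + Real.exp (-saddle n * k)) :=
    Finset.prod_pos fun k _ => by positivity
  unfold saddleSize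
  positivity

lemma tendsto_hookDistinct_div_saddleSize (h : ℕ) :
    Filter.Tendsto (fun n => hookDistinct h n / saddleSize n) Filter.atTop
      (nhds (√(12 / Real.pi) * hookConst h)) := by
  have h1 := (Complex.continuous_re.tendsto _).comp (tendsto_integral_peakIntegrand h)
  rw [Complex.ofReal_re] at h1
  refine h1.congr' ?_
  filter_upwards [eventually_saddle_pos] with n hn
  have h2 := hookDistinct_eq_integral h n hn
  rw [integral_distinctChar_mul_hookRatio h hn] at h2
  have h3 : ((hookDistinct h n : ℝ) : ℂ) = saddleSize n * ∫ t, peakIntegrand h n t := by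
    rw [Complex.ofReal_natCast, h2, saddleSize]
    push_cast
    ring
  have h4 := congrArg Complex.re h3
  rw [Complex.ofReal_re, Complex.re_ofReal_mul] at h4
  rw [h4, Function.comp, mul_div_cancel_left₀ _ (saddleSize_pos hn).ne']

lemma tendsto_saddleSize_div :
    Filter.Tendsto (fun n : ℕ => saddleSize n / ((3 : ℝ) ^ ((1 : ℝ) / 4)
        / (2 * Real.pi * (n : ℝ) ^ ((1 : ℝ) / 4)) * Real.exp (Real.pi * √((n : ℝ) / 3))))
      Filter.atTop (nhds (√(12 / Real.pi))⁻¹) := by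
  have hroot : ∀ x : ℝ, 0 ≤ x → x ^ ((1 : ℝ) / 4) = √√x := by
    intro x hx
    rw [Real.sqrt_eq_rpow, Real.sqrt_eq_rpow, ← Real.rpow_mul hx]
    norm_num
  have h1 := (Real.continuous_exp.tendsto _).comp tendsto_sum_log_one_add_exp
  have h2 := h1.mul_const (√(Real.pi / √12) / √√3)
  have h3 : Real.exp (-(Real.log 2 / 2)) * (√(Real.pi / √12) / √√3) = (√(12 / Real.pi))⁻¹ := by
    have h4 : Real.exp (-(Real.log 2 / 2)) = (√2)⁻¹ := by
      rw [Real.exp_neg, Real.exp_half, Real.exp_log two_pos]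
    have h5 : √3 * √12 = 6 := by
      rw [← Real.sqrt_mul (by norm_num), show (3 * 12 : ℝ) = 6 ^ 2 by norm_num,
        Real.sqrt_sq (by norm_num)]
    rw [h4, ← Real.sqrt_inv, ← Real.sqrt_inv, ← Real.sqrt_div (by positivity),
      ← Real.sqrt_mul (by norm_num)]
    congr 1
    rw [inv_div, div_div, mul_comm √12, h5]
    ring
  rw [h3] at h2
  refine h2.congr' ?_
  filter_upwards [Filter.eventually_ge_atTop 1] with n hn
  have hpos := saddle_pos hn
  have hn0 : (0 : ℝ) < n := by exact_mod_cast hn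
  rw [hroot 3 (by norm_num), hroot n hn0.le, saddleSize]
  have h4 : ∏ k ∈ Icc 1 n, (1 + Real.exp (-saddle n * k))
      = Real.exp (∑ k ∈ Icc 1 n, Real.log (1 + Real.exp (-saddle n * k))) := by
    rw [Real.exp_sum]
    exact Finset.prod_congr rfl fun k _ => (Real.exp_log (by positivity)).symm
  have h5 : Real.pi * √((n : ℝ) / 3) = saddle n * n + Real.pi ^ 2 / 12 / saddle n := by
    rw [div_eq_mul_inv (Real.pi ^ 2 / 12), ← natCast_mul_saddle hn, saddle]
    have h6 : √(12 * (n : ℝ)) = 6 * √((n : ℝ) / 3) := by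
      rw [show 12 * (n : ℝ) = 6 ^ 2 * (n / 3) by ring, Real.sqrt_mul (by norm_num),
        Real.sqrt_sq (by norm_num)]
    have h7 : √((n : ℝ) / 3) ^ 2 = n / 3 := Real.sq_sqrt (by positivity)
    have h8 : 0 < √((n : ℝ) / 3) := Real.sqrt_pos.2 (by positivity)
    rw [h6]
    field_simp
    linarith
  have h6 : √(Real.pi / √12) = √(saddle n) * √√(n : ℝ) := by
    have h8 : saddle n * √(n : ℝ) = Real.pi / √12 := by
      rw [saddle, Real.sqrt_mul (by norm_num : (0 : ℝ) ≤ 12)]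
      have := Real.sqrt_pos.2 hn0
      field_simp
    rw [← Real.sqrt_mul hpos.le, h8]
  rw [h4, h5, h6, Function.comp, Real.exp_sub, Real.exp_add]
  have h7 : 0 < √√(n : ℝ) := Real.sqrt_pos.2 (Real.sqrt_pos.2 hn0)
  field_simp

/-- For each `h ≥ 1` there is a constant `β_h` in the ℚ-span of `1` and `log 2` such that
`b_h(n) ~ β_h · 3^{1/4}/(2π n^{1/4}) · e^{π √(n/3)}` as `n → ∞`; moreover `β_h ∈ ℚ`
if and only if `h` is even. -/
theorem hookDistinct_asymptotic (h : ℕ) (hh : 1 ≤ h) :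
    ∃ β : ℝ, (∃ r s : ℚ, β = (r : ℝ) + (s : ℝ) * Real.log 2) ∧
      Filter.Tendsto
        (fun n : ℕ => (hookDistinct h n : ℝ) /
          (β * ((3 : ℝ) ^ ((1 : ℝ) / 4) / (2 * Real.pi * (n : ℝ) ^ ((1 : ℝ) / 4)) *
            Real.exp (Real.pi * Real.sqrt ((n : ℝ) / 3)))))
        Filter.atTop (nhds 1) ∧
      ((∃ r : ℚ, β = (r : ℝ)) ↔ Even h) := by
  have hβ := hookConst_pos hh
  refine ⟨hookConst h, exists_rat_hookConst h, ?_, hookConst_rat_iff h⟩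
  have h1 := ((tendsto_hookDistinct_div_saddleSize h).mul tendsto_saddleSize_div).mul_const
    (hookConst h)⁻¹
  have h2 : √(12 / Real.pi) * hookConst h * (√(12 / Real.pi))⁻¹ * (hookConst h)⁻¹ = 1 := by
    have : 0 < √(12 / Real.pi) := Real.sqrt_pos.2 (by positivity)
    field_simp
  rw [h2] at h1
  refine h1.congr' ?_
  filter_upwards [eventually_saddle_pos] with n hn
  rw [div_mul_div_cancel₀ (saddleSize_pos hn).ne', ← div_eq_mul_inv, div_div, mul_comm (hookConst h)]
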